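/- arXiv:2210.12576 — 4 statements merged into one kernel-verified Lean document; each statement's English description precedes it below -/
import Mathlib

section
/- Let k, l be coprime odd positive integers with k > 1 and kl nonsquare, such that k x² − l y² = 4 is solvable in odd positive integers x and y, and let ε = x₁√k + y₁√l where (x₁, y₁) is the minimal positive solution. Let (x, y) be a positive integer solution of k x² − l y² = 4. (i) If x = pⁿ x′ where p is a prime not dividing k, n is a positive integer, and every prime divisor of x′ divides k, then (x√k + y√l)/2 = ε/2, or (x√k + y√l)/2 = (ε/2)^q for some odd prime q with q ≠ p, except in the case (k, l, x, y) = (5, 1, 75025, 167761). (ii) If y = pⁿ y′ where p is a prime not dividing l, n is a positive integer, and every prime divisor of y′ divides l, then (x√k + y√l)/2 = ε/2, or (x√k + y√l)/2 = (ε/2)^q for some odd prime q with q ≠ p. -/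
def stR (A : ℤ) : ℕ → ℤ
  | 0 => 1
  | 1 => A - 3
  | (n+2) => (A - 2) * stR A (n+1) - stR A n

theorem stR_zero (A : ℤ) : stR A 0 = 1 := rfl
theorem stR_one (A : ℤ) : stR A 1 = A - 3 := rfl
theorem stR_add_two (A : ℤ) (n : ℕ) : stR A (n+2) = (A - 2) * stR A (n+1) - stR A n := rfl

/-- Field formula. -/
theorem stR_field {F : Type*} [Field F] (b c : F) (hbc : b * c = 1) (A : ℤ)
    (hA : (A : F) = (b + c) ^ 2) (j : ℕ) :
    (b + c) * (stR A j : F) = b ^ (2*j+1) + c ^ (2*j+1) := by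
  induction j using Nat.twoStepInduction with
  | zero => simp [stR_zero]
  | one =>
    rw [stR_one]; push_cast; rw [hA]
    linear_combination (3 * (b + c)) * hbc
  | more n h1 h2 =>
    rw [stR_add_two]; push_cast
    have e : (b + c) * (((A:F) - 2) * (stR A (n+1) : F) - (stR A n : F)) =
      ((A : F) - 2) * ((b + c) * (stR A (n+1) : F)) - (b + c) * (stR A n : F) := by ring
    rw [e, h1, h2, hA]
    have hs : (b + c)^2 - 2 = b^2 + c^2 := by linear_combination 2 * hbc
    rw [hs]
    linear_combination (b ^ (2*n+1) * (b*c+1) + c^(2*n+1) * (b*c+1)) * hbc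

theorem exists_bc {F : Type*} [Field F] [IsAlgClosed F] (A : F) :
    ∃ b c : F, b * c = 1 ∧ A = (b + c) ^ 2 := by
  obtain ⟨a, ha⟩ := IsAlgClosed.exists_pow_nat_eq A (n := 2) (by norm_num)
  have : ∃ b : F, (Polynomial.X ^ 2 - Polynomial.C a * Polynomial.X + Polynomial.C 1).IsRoot b := by
    apply IsAlgClosed.exists_root
    have : (Polynomial.X ^ 2 - Polynomial.C a * Polynomial.X + Polynomial.C 1 : Polynomial F).degree = 2 := by
      compute_degree!
    rw [this]; norm_num
  obtain ⟨b, hb⟩ := this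
  simp [Polynomial.IsRoot] at hb
  refine ⟨b, a - b, by linear_combination -hb, ?_⟩
  rw [← ha]; ring

theorem stR_comp (A : ℤ) (hA : A ≠ 0) (i j : ℕ) :
    stR A (2*i*j+i+j) = stR A i * stR (A * stR A i ^ 2) j := by
  obtain ⟨b, c, hbc, h⟩ := exists_bc (F := ℂ) (A : ℂ)
  have hA' : (b + c) ≠ 0 := by
    intro h0; rw [h0] at h; apply hA; simpa using h
  have h1 := stR_field b c hbc A h i
  have h2 := stR_field b c hbc A h (2*i*j+i+j)
  have h3 := stR_field (b^(2*i+1)) (c^(2*i+1)) (by rw [← mul_pow, hbc, one_pow])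
    (A * stR A i ^ 2) (by rw [← h1]; push_cast; rw [h]; ring) j
  rw [← h1, ← pow_mul, ← pow_mul, show (2*i+1)*(2*j+1) = 2*(2*i*j+i+j)+1 by ring, ← h2] at h3
  have := mul_left_cancel₀ hA' ((mul_assoc _ _ _).symm.trans h3)
  exact_mod_cast this.symm

theorem stR_frob (A : ℤ) (q j : ℕ) (hq : q.Prime) (hqj : q = 2*j+1) (h : (q:ℤ) ∣ stR A j) :
    (q:ℤ) ∣ A := by
  have := Fact.mk hq
  obtain ⟨b, c, hbc, hA⟩ := exists_bc (F := AlgebraicClosure (ZMod q)) (A : AlgebraicClosure (ZMod q))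
  have : CharP (AlgebraicClosure (ZMod q)) q := inferInstance
  have h1 := stR_field b c hbc A hA j
  rw [(CharP.intCast_eq_zero_iff (AlgebraicClosure (ZMod q)) q _).2 h, mul_zero, ← hqj,
    ← add_pow_char] at h1
  have h2 : b + c = 0 := pow_eq_zero_iff hq.ne_zero |>.1 h1.symm
  rw [h2] at hA
  exact (CharP.intCast_eq_zero_iff (AlgebraicClosure (ZMod q)) q _).1 (by simpa using hA)

theorem stR_taylor (A : ℤ) (j : ℕ) :
    A^2 ∣ 6 * stR A j - (-1)^j * ((2*j+1) * (6 - j*(j+1)*A)) := by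
  induction j using Nat.twoStepInduction with
  | zero => simp [stR_zero]
  | one => rw [stR_one]; exact ⟨0, by push_cast; ring⟩
  | more n h1 h2 =>
    obtain ⟨u, hu⟩ := h1
    obtain ⟨v, hv⟩ := h2
    rw [stR_add_two]
    refine ⟨(A-2) * v - u + (-1)^n * (2*n+3) * (n+1)*(n+2), ?_⟩
    push_cast at *
    linear_combination (A-2) * hv - hu

theorem stR_mod (A : ℤ) (j : ℕ) : A ∣ stR A j - (-1)^j * (2*j+1) := by
  induction j using Nat.twoStepInduction with
  | zero => simp [stR_zero]
  | one => rw [stR_one]; exact ⟨1, by push_cast; ring⟩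
  | more n h1 h2 =>
    obtain ⟨u, hu⟩ := h1
    obtain ⟨v, hv⟩ := h2
    rw [stR_add_two]
    refine ⟨(A-2) * v - u + (-1)^(n+1) * (2*n+3), ?_⟩
    push_cast at *
    linear_combination (A-2) * hv - hu

theorem dvd_of_both (A : ℤ) (r q j : ℕ) (hr : r.Prime) (hq : q.Prime) (hqj : q = 2*j+1)
    (h1 : (r:ℤ) ∣ A) (h2 : (r:ℤ) ∣ stR A j) : r = q := by
  have h3 := h1.trans (stR_mod A j)
  have h4 := (dvd_sub_right h2).1 h3
  have h5 : (r:ℤ) ∣ (2*j+1) := by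
    rcases neg_one_pow_eq_or ℤ j with h | h <;> rw [h] at h4
    · simpa using h4
    · rw [neg_one_mul] at h4; exact (dvd_neg).1 h4
  have h6 : r ∣ q := by rw [hqj]; exact_mod_cast h5
  exact (Nat.prime_dvd_prime_iff_eq hr hq).1 h6

theorem stR_pos_growth (A : ℤ) (hA : 5 ≤ A) (j : ℕ) :
    1 ≤ stR A j ∧ (A - 3) * stR A j ≤ stR A (j+1) := by
  induction j with
  | zero => simp [stR_zero, stR_one]
  | succ n ih =>
    obtain ⟨h1, h2⟩ := ih
    have : stR A n ≤ stR A (n+1) := by nlinarith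
    refine ⟨by linarith, ?_⟩
    rw [stR_add_two]; linarith

theorem stR_pos_pow (A c : ℤ) (hc : 2 ≤ c) (hA : 3 + c ≤ A) (j : ℕ) : c^j ≤ stR A j := by
  induction j with
  | zero => simp [stR_zero]
  | succ n ih =>
    obtain ⟨h1, h2⟩ := stR_pos_growth A (by linarith) n
    have : 0 ≤ c^n := by positivity
    rw [pow_succ]; nlinarith

theorem stR_neg_growth (A : ℤ) (hA : A ≤ -1) (j : ℕ) :
    1 ≤ (-1)^j * stR A j ∧ 2 * ((-1)^j * stR A j) ≤ (-1)^(j+1) * stR A (j+1) := by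
  induction j with
  | zero => simp [stR_zero, stR_one]; linarith
  | succ n ih =>
    obtain ⟨h1, h2⟩ := ih
    refine ⟨by linarith, ?_⟩
    rw [stR_add_two]
    have : (-1:ℤ)^(n+1+1) * ((A-2) * stR A (n+1) - stR A n) =
      (2-A) * ((-1)^(n+1) * stR A (n+1)) - (-1)^n * stR A n := by ring
    rw [this]; nlinarith

theorem stR_neg_pow (A : ℤ) (hA : A ≤ -1) (j : ℕ) : 2^(j+2) ≤ (-1)^(j+1) * stR A (j+1) := by
  induction j with
  | zero => simp [stR_one]; linarith
  | succ n ih =>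
    obtain ⟨h1, h2⟩ := stR_neg_growth A hA (n+1)
    rw [pow_succ]; linarith

theorem stR_size (A : ℤ) (hA : 5 ≤ A ∨ A ≤ -1) (j : ℕ) (hj : 2 ≤ j)
    (h : (stR A j).natAbs ≤ 2*j+1) : j = 2 ∧ A = 5 := by
  rcases hA with hA | hA
  · have hp := (stR_pos_growth A hA j).1
    have h' : stR A j ≤ 2*j+1 := by omega
    rcases eq_or_lt_of_le hA with h5 | h5
    · subst h5
      refine ⟨?_, rfl⟩
      by_contra hne
      have h3 := stR_pos_pow 5 2 le_rfl (by norm_num) j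
      have : (2*(j:ℤ)+1) < 2^j := by
        obtain ⟨t, rfl⟩ : ∃ t, j = t + 3 := ⟨j-3, by omega⟩
        clear * -
        induction t with
        | zero => norm_num
        | succ n ih => push_cast at *; rw [show n+1+3 = (n+3)+1 by ring, pow_succ]; linarith
      linarith
    · exfalso
      have h3 := stR_pos_pow A 3 (by norm_num) (by omega) j
      have : (2*(j:ℤ)+1) < 3^j := by
        obtain ⟨t, rfl⟩ : ∃ t, j = t + 2 := ⟨j-2, by omega⟩
        clear * -
        induction t with
        | zero => norm_num
        | succ n ih => push_cast at *; rw [show n+1+2 = (n+2)+1 by ring, pow_succ]; linarith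
      linarith
  · exfalso
    obtain ⟨t, rfl⟩ : ∃ t, j = t + 1 := ⟨j-1, by omega⟩
    have h3 := stR_neg_pow A hA t
    have h4 : (-1)^(t+1) * stR A (t+1) ≤ 2*(t+1)+1 := by
      rcases neg_one_pow_eq_or ℤ (t+1) with h | h <;> rw [h] <;> omega
    have : (2*((t:ℤ)+1)+1) < 2^(t+2) := by
      clear * -
      induction t with
      | zero => norm_num
      | succ n ih => push_cast at *; rw [show n+1+2 = (n+2)+1 by ring, pow_succ]; linarith
    linarith

theorem stR_ne_zero (A : ℤ) (hA : 5 ≤ A ∨ A ≤ -1) (j : ℕ) : stR A j ≠ 0 := by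
  intro h
  rcases hA with hA | hA
  · have := (stR_pos_growth A hA j).1; omega
  · have := (stR_neg_growth A hA j).1; rw [h] at this; simp at this

theorem stR_parity (A : ℤ) (hA : Odd A) (n : ℕ) :
    Odd (stR A (3*n)) ∧ Even (stR A (3*n+1)) ∧ Odd (stR A (3*n+2)) := by
  have step : ∀ n, stR A (n+2) % 2 = (stR A (n+1) + stR A n) % 2 := by
    intro n
    obtain ⟨a, rfl⟩ := hA
    rw [stR_add_two]
    rw [show (2*a+1-2) * stR (2*a+1) (n+1) - stR (2*a+1) n =
      (stR (2*a+1) (n+1) + stR (2*a+1) n) + 2 * ((a-1)* stR (2*a+1) (n+1) - stR (2*a+1) n) by ring]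
    omega
  simp only [Int.odd_iff, Int.even_iff] at *
  induction n with
  | zero =>
    have := step 0
    simp [stR_zero, stR_one] at *
    omega
  | succ n ih =>
    have h1 := step (3*n+1)
    have h2 := step (3*n+2)
    have h3 := step (3*n+3)
    rw [show 3*(n+1) = 3*n+3 by ring]
    simp only [show 3*n+1+2 = 3*n+3 by ring, show 3*n+2+2 = 3*n+4 by ring, show 3*n+3+2 = 3*n+5 by ring,
      show 3*n+1+1 = 3*n+2 by ring, show 3*n+2+1 = 3*n+3 by ring, show 3*n+3+1 = 3*n+4 by ring] at *
    omega

/-- Key lemma -/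
theorem lemM (A : ℤ) (hA : 5 ≤ A ∨ A ≤ -1) (hodd : Odd A) (i j q : ℕ) (hq : q.Prime)
    (hqj : q = 2*j+1)
    (h : ∀ r : ℕ, r.Prime → (r:ℤ) ∣ stR (A * stR A i ^ 2) j →
      (r:ℤ) ∣ A * stR A i ^ 2 ∨ r = q) :
    q = 5 ∧ A * stR A i ^ 2 = 5 := by
  set D := A * stR A i ^ 2 with hD
  have hR := stR_ne_zero A hA i
  have hR2 : 1 ≤ stR A i ^ 2 := by have : 0 < stR A i ^ 2 := by positivity
                                   omega
  have hDb : 5 ≤ D ∨ D ≤ -1 := by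
    rcases hA with hA | hA
    · left; nlinarith
    · right; nlinarith
  have hall : ∀ r : ℕ, r.Prime → r ∣ (stR D j).natAbs → r = q := by
    intro r hr hrd
    have hrd' : (r:ℤ) ∣ stR D j := Int.natCast_dvd.2 hrd
    rcases h r hr hrd' with h1 | h1
    · exact dvd_of_both D r q j hr hq hqj h1 hrd'
    · exact h1
  have hne : (stR D j).natAbs ≠ 0 := Int.natAbs_ne_zero.2 (stR_ne_zero D hDb j)
  have hpow := Nat.eq_prime_pow_of_unique_prime_dvd hne (fun {d} => hall d)
  set b := (stR D j).natAbs.primeFactorsList.length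
  have hj1 : 1 ≤ j := by have := hq.two_le; omega
  rcases eq_or_lt_of_le hj1 with hj | hj
  · -- q = 3
    exfalso
    subst hj
    have hq3 : q = 3 := by omega
    subst hq3
    rw [stR_one] at hpow
    have hb0 : b ≠ 0 := by
      intro h0; rw [h0] at hpow; omega
    obtain ⟨b', hb'⟩ := Nat.exists_eq_succ_of_ne_zero hb0
    rw [hb', pow_succ] at hpow
    have h3D : (3:ℤ) ∣ D := by omega
    have hoddp : Odd (3^b' : ℕ) := Odd.pow (by decide)
    obtain ⟨w, hw⟩ := hoddp
    have hDeven : Even D := by rw [Int.even_iff]; omega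
    have hRe : Even (stR A i) := by
      rw [hD, Int.even_mul, Int.even_pow] at hDeven
      rcases hDeven with h1 | h1
      · exact absurd hodd (Int.not_odd_iff_even.2 h1)
      · exact h1.1
    obtain ⟨t, ht⟩ : ∃ t, i = 3*t+1 := by
      obtain ⟨p1, p2, p3⟩ := stR_parity A hodd (i/3)
      have : i % 3 = 0 ∨ i % 3 = 1 ∨ i % 3 = 2 := by omega
      rcases this with h | h | h
      · rw [show 3*(i/3) = i by omega] at p1
        exact absurd p1 (Int.not_odd_iff_even.2 hRe)
      · exact ⟨i/3, by omega⟩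
      · rw [show 3*(i/3)+2 = i by omega] at p3
        exact absurd p3 (Int.not_odd_iff_even.2 hRe)
    have hcomp := stR_comp A (by omega) t 1
    rw [show 2*t*1+t+1 = i by omega, stR_one] at hcomp
    set E := A * stR A t ^ 2 with hE
    have hDE : D = E * (E-3)^2 := by rw [hD, hcomp, hE]; ring
    have h3E : (3:ℤ) ∣ E := by
      rw [hDE] at h3D
      rcases Int.prime_three.dvd_or_dvd h3D with h1 | h1
      · exact h1
      · have := Int.prime_three.dvd_of_dvd_pow h1; omega
    obtain ⟨e, he⟩ := h3E
    have h27 : D = 27 * (e * (e-1)^2) := by rw [hDE, he]; ring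
    generalize e * (e-1)^2 = f at h27
    rcases Nat.eq_zero_or_pos b' with h0 | h0
    · rw [h0] at hpow; omega
    · obtain ⟨b'', hb''⟩ := Nat.exists_eq_succ_of_ne_zero h0.ne'
      rw [hb'', pow_succ] at hpow
      omega
  · -- q ≥ 5
    have hle : (stR D j).natAbs ≤ 2*j+1 := by
      by_contra hgt
      push Not at hgt
      have hb2 : 2 ≤ b := by
        by_contra hb
        have : b = 0 ∨ b = 1 := by omega
        rcases this with h0 | h0 <;> rw [h0] at hpow <;> simp at hpow <;> omega
      have hqq : q^2 ∣ (stR D j).natAbs := by rw [hpow]; exact pow_dvd_pow _ hb2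
      have hqq' : (q:ℤ)^2 ∣ stR D j := by
        have := Int.natCast_dvd.2 hqq
        exact_mod_cast this
      have hqD : (q:ℤ) ∣ D := stR_frob D q j hq hqj ((dvd_pow_self _ two_ne_zero).trans hqq')
      have h1 : (q:ℤ)^2 ∣ 6 * stR D j - (-1)^j * ((2*j+1) * (6 - j*(j+1)*D)) :=
        (pow_dvd_pow_of_dvd hqD 2).trans (stR_taylor D j)
      have h2 := (dvd_sub_right (hqq'.mul_left 6)).1 h1
      have h3 : (q:ℤ)^2 ∣ ((2*j+1) * (6 - j*(j+1)*D)) := by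
        rcases neg_one_pow_eq_or ℤ j with h | h <;> rw [h] at h2
        · rwa [one_mul] at h2
        · rw [neg_one_mul] at h2; exact (dvd_neg).1 h2
      have hqj' : (2*(j:ℤ)+1) = q := by rw [hqj]; push_cast; ring
      rw [hqj', pow_two] at h3
      have h4 := Int.dvd_of_mul_dvd_mul_left (by exact_mod_cast hq.ne_zero) h3
      have h5 : (q:ℤ) ∣ 6 := (dvd_sub_left (hqD.mul_left _)).1 h4
      have h6 : q ∣ 6 := by exact_mod_cast h5
      have : q ≤ 6 := Nat.le_of_dvd (by norm_num) h6
      interval_cases q <;> omega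
    obtain ⟨a1, a2⟩ := stR_size D hDb j hj hle
    exact ⟨by omega, a2⟩

theorem five_case (A : ℤ) (hA : 5 ≤ A ∨ A ≤ -1) (i : ℕ) (h : A * stR A i ^ 2 = 5) :
    A = 5 ∧ i = 0 := by
  have hR := stR_ne_zero A hA i
  have hR2 : 1 ≤ stR A i ^ 2 := by have : 0 < stR A i ^ 2 := by positivity
                                   omega
  have hA5 : A = 5 := by
    rcases hA with hA | hA <;> nlinarith
  refine ⟨hA5, ?_⟩
  subst hA5
  by_contra hi
  have h1 := stR_pos_pow 5 2 le_rfl (by norm_num) i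
  obtain ⟨t, rfl⟩ : ∃ t, i = t + 1 := ⟨i - 1, by omega⟩
  have h2 : (2:ℤ)^(t+1) ≥ 2 := by
    rw [pow_succ]; have : (1:ℤ) ≤ 2^t := one_le_pow₀ (by norm_num)
    linarith
  have : 2 ≤ stR 5 (t+1) := by simpa using h2.le.trans h1
  nlinarith

theorem core (σ : ℤ) (hσ : σ = 1 ∨ σ = -1) (K z : ℕ) (A : ℤ) (hAK : A = σ * (K * z^2))
    (hA : 5 ≤ A ∨ A ≤ -1) (hodd : Odd A) (p : ℕ) (hp : p.Prime) (hpK : ¬ p ∣ K) (M : ℕ)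
    (hpz : (p:ℤ) ∣ z * stR A M)
    (hall : ∀ r : ℕ, r.Prime → (r:ℤ) ∣ z * stR A M → r ∣ K ∨ r = p) :
    M = 0 ∨ ((2*M+1).Prime ∧ 2*M+1 ≠ p) ∨ (A = 5 ∧ M = 12) := by
  by_contra hcon
  push Not at hcon
  obtain ⟨hM, hM2, hM3⟩ := hcon
  have hA0 : A ≠ 0 := by omega
  have hKA : (K:ℤ) ∣ A := ⟨σ * z^2, by rw [hAK]; ring⟩
  have fact : ∀ m q : ℕ, q.Prime → q ∣ 2*m+1 → ∃ i j, q = 2*j+1 ∧ 2*m+1 = q*(2*i+1) ∧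
      stR A m = stR A i * stR (A * stR A i ^ 2) j := by
    intro m q hq ⟨s, hs⟩
    have ho : Odd (q*s) := by rw [← hs]; exact ⟨m, rfl⟩
    obtain ⟨⟨j, hj⟩, ⟨i, hi⟩⟩ := Nat.odd_mul.1 ho
    refine ⟨i, j, hj, by rw [hs, hi], ?_⟩
    rw [← stR_comp A hA0]
    congr 1
    rw [hj, hi] at hs
    have : (2*j+1)*(2*i+1) = 2*(2*i*j+i+j)+1 := by ring
    omega
  -- the main claim for prime factors
  have claim1 : ∀ q i j : ℕ, q.Prime → q = 2*j+1 → 2*M+1 = q*(2*i+1) →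
      stR A M = stR A i * stR (A * stR A i ^ 2) j →
      (p:ℤ) ∣ stR (A * stR A i ^ 2) j ∧ p ≠ q := by
    intro q i j hq hj hm hR
    by_contra hc
    have := lemM A hA hodd i j q hq hj (by
      intro r hr hrd
      rcases hall r hr (by rw [hR]; exact (hrd.mul_left _).mul_left _) with h | h
      · left; exact ((Int.natCast_dvd_natCast.2 h).trans hKA).mul_right _
      · right; subst h
        by_contra hne; exact hc ⟨hrd, hne⟩)
    obtain ⟨h5, hD⟩ := this
    obtain ⟨hA5, hi⟩ := five_case A hA i hD
    subst hi
    have hM2' : M = 2 := by omega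
    subst hM2'
    subst hA5
    have hz : (K:ℤ) * z^2 = 5 := by
      rcases hσ with h | h <;> rw [h] at hAK
      · linarith
      · have : (0:ℤ) ≤ K * z^2 := by positivity
        linarith
    have hz' : K * z^2 = 5 := by exact_mod_cast hz
    have hp5 : (p:ℤ) ∣ 5 ^ 2 := by
      have e : stR 5 2 = 5 := by decide
      rw [e] at hpz
      have : (z:ℤ) * 5 ∣ 5 ^ 2 := by
        rw [pow_two]; exact mul_dvd_mul ⟨K * z, by rw [← hz]; ring⟩ dvd_rfl
      exact hpz.trans this
    have hp5' : p ∣ 5 := hp.dvd_of_dvd_pow (n := 2) (by exact_mod_cast hp5)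
    have hp5'' : p = 5 := (Nat.prime_dvd_prime_iff_eq hp (by norm_num)).1 hp5'
    rw [← hz'] at hp5'
    rcases (Nat.Prime.dvd_mul hp).1 hp5' with h | h
    · exact hpK h
    · have := hp.dvd_of_dvd_pow h
      subst hp5''
      obtain ⟨w, rfl⟩ := this
      have : 25 ∣ 5 := ⟨K * w^2, by rw [← hz']; ring⟩
      omega
  have hncop : ¬ (2*M+1).Prime := by
    intro hpr
    obtain ⟨i, j, h1, h2, h3⟩ := fact M _ hpr dvd_rfl
    exact (claim1 _ i j hpr h1 h2 h3).2 (hM2 hpr).symm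
  have claim2 : ∀ q : ℕ, q.Prime → q ∣ 2*M+1 → 2*M+1 = q*5 ∧ A = 5 := by
    intro q hq hqm
    obtain ⟨i, j, h1, h2, h3⟩ := fact M q hq hqm
    obtain ⟨c1, c2⟩ := claim1 q i j hq h1 h2 h3
    have hpi : ¬ (p:ℤ) ∣ stR A i := by
      intro h
      exact c2 (dvd_of_both _ p q j hp hq h1 ((h.trans (dvd_pow_self _ two_ne_zero)).mul_left _) c1)
    have hi : 2*i+1 ≠ 1 := by
      intro h; rw [h, mul_one] at h2; rw [h2] at hncop; exact hncop hq
    obtain ⟨r, hr, hrs⟩ := Nat.exists_prime_and_dvd hi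
    obtain ⟨t, u, g1, g2, g3⟩ := fact i r hr hrs
    have := lemM A hA hodd t u r hr g1 (by
      intro w hw hwd
      left
      rcases hall w hw (by rw [h3, g3]; exact ((hwd.mul_left _).mul_right _).mul_left _) with h | h
      · exact ((Int.natCast_dvd_natCast.2 h).trans hKA).mul_right _
      · subst h; exfalso; apply hpi; rw [g3]; exact hwd.mul_left _)
    obtain ⟨h5, hD⟩ := this
    obtain ⟨hA5, ht⟩ := five_case A hA t hD
    refine ⟨?_, hA5⟩
    rw [h2, g2, ht, h5]
  obtain ⟨q, hq, hqm⟩ := Nat.exists_prime_and_dvd (n := 2*M+1) (by omega)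
  have h1 := (claim2 q hq hqm).1
  have h2 := claim2 5 (by norm_num) ⟨q, by rw [h1]; ring⟩
  exact hM3 h2.2 (by omega)

theorem norm_real (k l : ℕ) (x y : ℤ) (h : (k:ℤ) * x^2 - l * y^2 = 4) :
    ((x:ℝ) * √(k:ℝ) + y * √(l:ℝ)) * ((x:ℝ) * √(k:ℝ) - y * √(l:ℝ)) = 4 := by
  have hk : √(k:ℝ) ^ 2 = k := Real.sq_sqrt (Nat.cast_nonneg k)
  have hl : √(l:ℝ) ^ 2 = l := Real.sq_sqrt (Nat.cast_nonneg l)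
  have h' : (k:ℝ) * x^2 - l * y^2 = 4 := by exact_mod_cast h
  linear_combination h' + (x:ℝ)^2 * hk - (y:ℝ)^2 * hl

theorem sol_inj (k l : ℕ) (hk : 0 < k) (hl : 0 < l) (x y u v : ℤ)
    (h : (k:ℤ) * x^2 - l * y^2 = 4) (h' : (k:ℤ) * u^2 - l * v^2 = 4)
    (e : (x:ℝ) * √(k:ℝ) + y * √(l:ℝ) = u * √(k:ℝ) + v * √(l:ℝ)) : x = u ∧ y = v := by
  have n1 := norm_real k l x y h
  have n2 := norm_real k l u v h'
  have hne : (u:ℝ) * √(k:ℝ) + v * √(l:ℝ) ≠ 0 := by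
    intro h0; rw [h0] at n2; norm_num at n2
  rw [e, ← n2] at n1
  have e2 := mul_left_cancel₀ hne n1
  have hk0 : √(k:ℝ) ≠ 0 := (Real.sqrt_pos.2 (by exact_mod_cast hk)).ne'
  have hl0 : √(l:ℝ) ≠ 0 := (Real.sqrt_pos.2 (by exact_mod_cast hl)).ne'
  constructor
  · have : (x:ℝ) = u := mul_right_cancel₀ hk0 (by linarith)
    exact_mod_cast this
  · have : (y:ℝ) = v := mul_right_cancel₀ hl0 (by linarith)
    exact_mod_cast this

theorem pow_formula (k l : ℕ) (x y : ℤ) (h : (k:ℤ) * x^2 - l * y^2 = 4) (j : ℕ) :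
    (((x:ℝ) * √(k:ℝ) + y * √(l:ℝ)) / 2) ^ (2*j+1) =
      (((x * stR (k*x^2) j : ℤ):ℝ) * √(k:ℝ) +
        ((y * ((-1)^j * stR (-1 * (l * y^2)) j) : ℤ) : ℝ) * √(l:ℝ)) / 2 := by
  have hn := norm_real k l x y h
  have hk : √(k:ℝ) ^ 2 = k := Real.sq_sqrt (Nat.cast_nonneg k)
  have hl : √(l:ℝ) ^ 2 = l := Real.sq_sqrt (Nat.cast_nonneg l)
  have h' : (k:ℝ) * x^2 - l * y^2 = 4 := by exact_mod_cast h
  set a := ((x:ℝ) * √(k:ℝ) + y * √(l:ℝ)) / 2 with ha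
  set b := ((x:ℝ) * √(k:ℝ) - y * √(l:ℝ)) / 2 with hb
  have hab : a * b = 1 := by rw [ha, hb]; linear_combination hn / 4
  have hs : a + b = x * √(k:ℝ) := by rw [ha, hb]; ring
  have hA : (((k:ℤ)*x^2 : ℤ) : ℝ) = (a+b)^2 := by
    rw [hs]; push_cast; linear_combination -(x:ℝ)^2 * hk
  have hd : a - b = y * √(l:ℝ) := by rw [ha, hb]; ring
  have hC : (((l:ℤ)*y^2 : ℤ) : ℝ) = (a-b)^2 := by
    rw [hd]; push_cast; linear_combination -(y:ℝ)^2 * hl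
  have f1 := stR_field a b hab _ hA j
  have f2 : ∀ j : ℕ, (a - b) * ((-1)^j * (stR (-1 * (l*y^2)) j : ℝ)) = a^(2*j+1) - b^(2*j+1) := by
    intro j
    induction j using Nat.twoStepInduction with
    | zero => simp [stR_zero]
    | one =>
      rw [stR_one]; push_cast at *; rw [hC]
      linear_combination (-3 * (a - b)) * hab
    | more n h1 h2 =>
      rw [stR_add_two]; push_cast at *
      rw [hC] at *
      have hs' : (a-b)^2 + 2 = a^2+b^2 := by linear_combination -2 * hab
      have e : (a - b) * ((-1)^(n+2) * ((-1 * (a-b)^2 - 2) * (stR (-1 * (l*y^2)) (n+1) : ℝ)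
          - (stR (-1 * (l*y^2)) n : ℝ))) =
        ((a-b)^2 + 2) * ((a-b) * ((-1)^(n+1) * (stR (-1 * (l*y^2)) (n+1) : ℝ)))
          - (a - b) * ((-1)^n * (stR (-1 * (l*y^2)) n : ℝ)) := by ring
      rw [e, h1, h2, hs']
      linear_combination (a ^ (2*n+1) * (a*b+1) - b^(2*n+1) * (a*b+1)) * hab
  have f2' := f2 j
  rw [hs] at f1
  rw [hd] at f2'
  push_cast at *
  linear_combination -(f1 + f2') / 2

theorem pow_norm (k l : ℕ) (x y : ℤ) (h : (k:ℤ) * x^2 - l * y^2 = 4) (j : ℕ) :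
    (k:ℤ) * (x * stR (k*x^2) j)^2 - l * (y * ((-1)^j * stR (-1 * (l * y^2)) j))^2 = 4 := by
  have h1 := pow_formula k l x y h j
  have hm : (k:ℤ) * x^2 - l * (-y)^2 = 4 := by linarith
  have h2 := pow_formula k l x (-y) hm j
  have hn := norm_real k l x y h
  have hk : √(k:ℝ) ^ 2 = k := Real.sq_sqrt (Nat.cast_nonneg k)
  have hl : √(l:ℝ) ^ 2 = l := Real.sq_sqrt (Nat.cast_nonneg l)
  have e : (((x:ℝ) * √(k:ℝ) + y * √(l:ℝ)) / 2) ^ (2*j+1) *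
      (((x:ℝ) * √(k:ℝ) + (-y : ℤ) * √(l:ℝ)) / 2) ^ (2*j+1) = 1 := by
    rw [← mul_pow]
    have : ((x:ℝ) * √(k:ℝ) + y * √(l:ℝ)) / 2 * (((x:ℝ) * √(k:ℝ) + (-y : ℤ) * √(l:ℝ)) / 2) = 1 := by
      push_cast; linear_combination hn / 4
    rw [this, one_pow]
  rw [h1, h2, neg_sq] at e
  have : (((k:ℤ) * (x * stR (k*x^2) j)^2 - l * (y * ((-1)^j * stR (-1 * (l * y^2)) j))^2 : ℤ) : ℝ) = 4 := by
    push_cast at e ⊢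
    generalize (stR (k*x^2) j : ℝ) = r1 at *
    generalize (stR (-1 * (l*y^2)) j : ℝ) = r2 at *
    generalize ((-1:ℝ)^j) = s at *
    linear_combination 4 * e - (x*r1)^2 * hk + (y*(s*r2))^2 * hl
  exact_mod_cast this

theorem par_lem (k l : ℕ) (hok : Odd k) (hol : Odd l) (x y : ℤ)
    (h : (k:ℤ) * x^2 - l * y^2 = 4) : Even x ↔ Even y := by
  have h2 : Even ((k:ℤ) * x^2 - l * y^2) := by rw [h]; decide
  have hk : ¬ Even (k:ℤ) := by simpa using hok
  have hl : ¬ Even (l:ℤ) := by simpa using hol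
  rw [Int.even_sub, Int.even_mul, Int.even_mul, Int.even_pow, Int.even_pow] at h2
  tauto

set_option maxHeartbeats 1000000 in
theorem all_sols (k l : ℕ) (hk : 1 < k) (hl : 0 < l) (hok : Odd k) (hol : Odd l)
    (x₁ y₁ : ℕ) (hx₁ : 0 < x₁) (hy₁ : 0 < y₁)
    (hsol₁ : (k : ℤ) * (x₁ : ℤ) ^ 2 - (l : ℤ) * (y₁ : ℤ) ^ 2 = 4)
    (hmin : ∀ u v : ℕ, 0 < u → 0 < v →
      (k : ℤ) * (u : ℤ) ^ 2 - (l : ℤ) * (v : ℤ) ^ 2 = 4 →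
      (x₁ : ℝ) * Real.sqrt k + (y₁ : ℝ) * Real.sqrt l ≤
        (u : ℝ) * Real.sqrt k + (v : ℝ) * Real.sqrt l) :
    ∀ (x y : ℕ), 0 < x → 0 < y →
    (k : ℤ) * (x : ℤ) ^ 2 - (l : ℤ) * (y : ℤ) ^ 2 = 4 →
    ∃ j : ℕ, ((x:ℝ) * √(k:ℝ) + y * √(l:ℝ)) / 2 = (((x₁:ℝ) * √(k:ℝ) + y₁ * √(l:ℝ)) / 2) ^ (2*j+1) := by
  intro x
  induction x using Nat.strong_induction_on with
  | _ x ih =>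
  intro y hx hy hsol
  have hk0 : 0 < √(k:ℝ) := Real.sqrt_pos.2 (by exact_mod_cast (by omega : 0 < k))
  have hl0 : 0 < √(l:ℝ) := Real.sqrt_pos.2 (by exact_mod_cast hl)
  have hks : √(k:ℝ) ^ 2 = k := Real.sq_sqrt (Nat.cast_nonneg k)
  have hls : √(l:ℝ) ^ 2 = l := Real.sq_sqrt (Nat.cast_nonneg l)
  have hmxy := hmin x y hx hy hsol
  rcases eq_or_lt_of_le hmxy with heq | hlt
  · exact ⟨0, by rw [heq]; simp⟩
  have p1 := par_lem k l hok hol x₁ y₁ hsol₁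
  have p2 := par_lem k l hok hol x y hsol
  have hkz : Odd (k:ℤ) := by exact_mod_cast hok
  have hlz : Odd (l:ℤ) := by exact_mod_cast hol
  have hkz' : ¬ Even (k:ℤ) := Int.not_even_iff_odd.2 hkz
  have hlz' : ¬ Even (l:ℤ) := Int.not_even_iff_odd.2 hlz
  have eX : Even ((x:ℤ) * (k*x₁^2 - 2) - l * y * x₁ * y₁) := by
    have : Even (2:ℤ) := even_two
    simp only [Int.even_sub, Int.even_mul, Int.even_pow]
    tauto
  have eY : Even ((y:ℤ) * (k*x₁^2 - 2) - k * x * x₁ * y₁) := by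
    have : Even (2:ℤ) := even_two
    simp only [Int.even_sub, Int.even_mul, Int.even_pow]
    tauto
  obtain ⟨X, hX⟩ := eX
  obtain ⟨Y, hY⟩ := eY
  have hXY : (k:ℤ) * X^2 - l * Y^2 = 4 := by
    have h4 : 4 * ((k:ℤ) * X^2 - l * Y^2) = 4 * 4 := by
      have e1 : 4 * ((k:ℤ) * X^2 - l * Y^2) = k * (X+X)^2 - l * (Y+Y)^2 := by ring
      rw [e1, ← hX, ← hY]
      have hl1 : (l:ℤ) * y₁^2 = k * x₁^2 - 4 := by linarith
      have e2 : (k:ℤ) * ((x:ℤ) * (k*x₁^2 - 2) - l * y * x₁ * y₁)^2 -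
        l * ((y:ℤ) * (k*x₁^2 - 2) - k * x * x₁ * y₁)^2 =
        (k*x^2-l*y^2) * ((k*x₁^2-2)^2 - k * x₁^2 * (l * y₁^2)) := by ring
      rw [e2, hl1, hsol]; ring
    linarith
  set α := ((x₁:ℝ) * √(k:ℝ) + y₁ * √(l:ℝ)) / 2 with hα
  set α' := ((x₁:ℝ) * √(k:ℝ) - y₁ * √(l:ℝ)) / 2 with hα'
  set γ := ((x:ℝ) * √(k:ℝ) + y * √(l:ℝ)) / 2 with hγ
  have hn : α * α' = 1 := by
    have := norm_real k l x₁ y₁ hsol₁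
    push_cast at this
    rw [hα, hα']; linear_combination this / 4
  have hXr : (x:ℝ) * (k*x₁^2 - 2) - l * y * x₁ * y₁ = X + X := by exact_mod_cast hX
  have hYr : (y:ℝ) * (k*x₁^2 - 2) - k * x * x₁ * y₁ = Y + Y := by exact_mod_cast hY
  have hα0 : 0 < α := by positivity
  have hγ0 : 0 < γ := by positivity
  have hα'0 : 0 < α' := (pos_iff_pos_of_mul_pos (by rw [hn]; norm_num)).1 hα0
  have hαγ : α < γ := by rw [hα, hγ]; linarith
  have hsol₁r : (k:ℝ) * x₁^2 - l * y₁^2 = 4 := by exact_mod_cast hsol₁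
  -- the quotient
  have hq : ((X:ℝ) * √(k:ℝ) + Y * √(l:ℝ)) / 2 = γ * α'^2 := by
    have e3 : α'^2 = (k*x₁^2 - 2 - x₁ * y₁ * (√(k:ℝ) * √(l:ℝ))) / 2 := by
      rw [hα']
      linear_combination (x₁:ℝ)^2 * hks / 4 + (y₁:ℝ)^2 * hls / 4 - hsol₁r / 4
    rw [e3, hγ]
    linear_combination (-(√(k:ℝ)) * hXr - √(l:ℝ) * hYr) / 4 + (x * x₁ * y₁ * √(l:ℝ)) / 4 * hks
      + (y * x₁ * y₁ * √(k:ℝ)) / 4 * hls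
  have hnXY := norm_real k l X Y hXY
  have hα'1 : α' < 1 := by
    have : α' < α := by
      rw [hα, hα']
      have : 0 < (y₁:ℝ) * √(l:ℝ) := by positivity
      linarith
    by_contra hc; push Not at hc; clear * - hc this hn; nlinarith
  have hXYp : 0 < ((X:ℝ) * √(k:ℝ) + Y * √(l:ℝ)) := by
    have : 0 < γ * α'^2 := by positivity
    linarith
  have hXYm : 0 < ((X:ℝ) * √(k:ℝ) - Y * √(l:ℝ)) :=
    (pos_iff_pos_of_mul_pos (by rw [hnXY]; norm_num)).1 hXYp
  have hXpos : 0 < X := by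
    have : 0 < (X:ℝ) * √(k:ℝ) := by linarith
    have := (pos_iff_pos_of_mul_pos this).2 hk0
    exact_mod_cast this
  have hgt : α' < γ * α'^2 := by
    have : γ * α'^2 - α' = (γ - α) * α'^2 := by linear_combination α' * hn
    have h2 : 0 < (γ - α) * α'^2 := by
      apply mul_pos (by linarith); positivity
    linarith
  have hlt2 : γ * α'^2 < γ := by
    have : α'^2 < 1 := by clear * - hα'0 hα'1; nlinarith
    clear * - this hγ0; nlinarith
  lift X to ℕ using hXpos.le
  have hX0 : 0 < X := by exact_mod_cast hXpos
  rcases lt_trichotomy Y 0 with hY0 | hY0 | hY0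
  · exfalso
    obtain ⟨W, hW⟩ : ∃ W : ℕ, Y = -W := ⟨Y.natAbs, by omega⟩
    subst hW
    have hW0 : 0 < W := by omega
    have := hmin X W hX0 hW0 (by rw [← hXY]; ring)
    push_cast at hnXY hq hXYp
    have e5 : ((X:ℝ) * √(k:ℝ) + W * √(l:ℝ)) / 2 * (γ * α'^2) = 1 := by
      rw [← hq]; linear_combination hnXY / 4
    have h6 : α ≤ ((X:ℝ) * √(k:ℝ) + W * √(l:ℝ)) / 2 := by rw [hα]; linarith
    have h7 : α * α' < ((X:ℝ) * √(k:ℝ) + W * √(l:ℝ)) / 2 * (γ * α'^2) :=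
      mul_lt_mul' h6 hgt hα'0.le (hα0.trans_le h6)
    rw [hn, e5] at h7
    exact lt_irrefl _ h7
  · exfalso
    subst hY0
    have hd : (k:ℤ) ∣ 4 := ⟨X^2, by linarith⟩
    have hd' : k ∣ 4 := by exact_mod_cast hd
    have : k ≤ 4 := Nat.le_of_dvd (by norm_num) hd'
    obtain ⟨w, hw⟩ := hok
    have : k = 3 := by omega
    subst this; omega
  · lift Y to ℕ using hY0.le
    have hY0' : 0 < Y := by exact_mod_cast hY0
    have hXx : X < x := by
      by_contra hc
      push Not at hc
      have hYy : y ≤ Y := by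
        by_contra hc2
        push Not at hc2
        have a1 : (x:ℤ)^2 ≤ (X:ℤ)^2 := by
          have : (x:ℤ) ≤ X := by exact_mod_cast hc
          gcongr
        have a2 : (Y:ℤ)^2 < (y:ℤ)^2 := by
          have : (Y:ℤ) < y := by exact_mod_cast hc2
          gcongr
        have hkp : (0:ℤ) < k := by omega
        have hlp : (0:ℤ) < l := by omega
        have a3 := mul_le_mul_of_nonneg_left a1 hkp.le
        have a4 := mul_lt_mul_of_pos_left a2 hlp
        linarith
      have a1 : (x:ℝ) * √(k:ℝ) ≤ X * √(k:ℝ) := by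
        have : (x:ℝ) ≤ X := by exact_mod_cast hc
        gcongr
      have a2 : (y:ℝ) * √(l:ℝ) ≤ Y * √(l:ℝ) := by
        have : (y:ℝ) ≤ Y := by exact_mod_cast hYy
        gcongr
      rw [← hq, hγ] at hlt2
      push_cast at hlt2
      linarith
    obtain ⟨j, hj⟩ := ih X hXx Y hX0 hY0' hXY
    refine ⟨j+1, ?_⟩
    push_cast at hq
    rw [hq] at hj
    rw [show 2*(j+1)+1 = (2*j+1) + 2 by ring, pow_add, ← hj]
    linear_combination (-γ * (α * α' + 1)) * hn

theorem stormer_main (k l : ℕ) (hk : 1 < k) (hl : 0 < l)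
    (hok : Odd k) (hol : Odd l)
    (hsolvable : ∃ u v : ℕ, 0 < u ∧ 0 < v ∧ Odd u ∧ Odd v ∧
      (k : ℤ) * (u : ℤ) ^ 2 - (l : ℤ) * (v : ℤ) ^ 2 = 4)
    (x₁ y₁ : ℕ) (hx₁ : 0 < x₁) (hy₁ : 0 < y₁)
    (hsol₁ : (k : ℤ) * (x₁ : ℤ) ^ 2 - (l : ℤ) * (y₁ : ℤ) ^ 2 = 4)
    (hmin : ∀ u v : ℕ, 0 < u → 0 < v →
      (k : ℤ) * (u : ℤ) ^ 2 - (l : ℤ) * (v : ℤ) ^ 2 = 4 →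
      (x₁ : ℝ) * Real.sqrt k + (y₁ : ℝ) * Real.sqrt l ≤
        (u : ℝ) * Real.sqrt k + (v : ℝ) * Real.sqrt l)
    (x y : ℕ) (hx : 0 < x) (hy : 0 < y)
    (hsol : (k : ℤ) * (x : ℤ) ^ 2 - (l : ℤ) * (y : ℤ) ^ 2 = 4) :
    Odd ((k:ℤ) * x₁^2) ∧ Odd (-1 * ((l:ℤ) * y₁^2)) ∧ 5 ≤ (k:ℤ) * x₁^2 ∧ -1 * ((l:ℤ) * y₁^2) ≤ -1 ∧
    ∃ j : ℕ, ((x:ℝ) * √(k:ℝ) + y * √(l:ℝ)) / 2 = (((x₁:ℝ) * √(k:ℝ) + y₁ * √(l:ℝ)) / 2) ^ (2*j+1) ∧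
      (x:ℤ) = x₁ * stR (k*x₁^2) j ∧ (y:ℤ) = y₁ * ((-1)^j * stR (-1 * (l * y₁^2)) j) := by
  have key : ∀ x y : ℕ, 0 < x → 0 < y → (k : ℤ) * (x : ℤ) ^ 2 - (l : ℤ) * (y : ℤ) ^ 2 = 4 →
      ∃ j : ℕ, ((x:ℝ) * √(k:ℝ) + y * √(l:ℝ)) / 2 = (((x₁:ℝ) * √(k:ℝ) + y₁ * √(l:ℝ)) / 2) ^ (2*j+1) ∧
      (x:ℤ) = x₁ * stR (k*x₁^2) j ∧ (y:ℤ) = y₁ * ((-1)^j * stR (-1 * (l * y₁^2)) j) := by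
    intro x y hx hy hsol
    obtain ⟨j, hj⟩ := all_sols k l hk hl hok hol x₁ y₁ hx₁ hy₁ hsol₁ hmin x y hx hy hsol
    refine ⟨j, hj, ?_⟩
    have h1 := pow_formula k l x₁ y₁ hsol₁ j
    have h2 := pow_norm k l x₁ y₁ hsol₁ j
    apply sol_inj k l (by omega) hl x y _ _ hsol h2
    rw [Int.cast_natCast, Int.cast_natCast] at h1
    rw [h1] at hj
    rw [Int.cast_natCast, Int.cast_natCast]
    linarith
  obtain ⟨u, v, hu, hv, hou, hov, huv⟩ := hsolvable
  obtain ⟨j, -, h1, h2⟩ := key u v hu hv huv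
  have ox : Odd (x₁:ℤ) := by
    have : Odd (u:ℤ) := by exact_mod_cast hou
    rw [h1] at this; exact (Int.odd_mul.1 this).1
  have oy : Odd (y₁:ℤ) := by
    have : Odd (v:ℤ) := by exact_mod_cast hov
    rw [h2] at this; exact (Int.odd_mul.1 this).1
  have hkz : Odd (k:ℤ) := by exact_mod_cast hok
  have hlz : Odd (l:ℤ) := by exact_mod_cast hol
  have hly : 0 < (l:ℤ) * y₁^2 := by positivity
  refine ⟨hkz.mul ox.pow, ?_, by linarith, by linarith, key x y hx hy hsol⟩
  exact Odd.mul (by decide) (hlz.mul oy.pow)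

/-- Extension of Störmer's theorem for `k x² - l y² = 4` with `k > 1`, `k, l`
odd and coprime, solvable in odd positive integers: one extra prime version. -/
theorem stormer_kl_four_one_prime (k l : ℕ) (hk : 1 < k) (hl : 0 < l)
    (hok : Odd k) (hol : Odd l)
    (hco : Nat.Coprime k l) (hns : ¬ IsSquare (k * l))
    (hsolvable : ∃ u v : ℕ, 0 < u ∧ 0 < v ∧ Odd u ∧ Odd v ∧
      (k : ℤ) * (u : ℤ) ^ 2 - (l : ℤ) * (v : ℤ) ^ 2 = 4)
    (x₁ y₁ : ℕ) (hx₁ : 0 < x₁) (hy₁ : 0 < y₁)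
    (hsol₁ : (k : ℤ) * (x₁ : ℤ) ^ 2 - (l : ℤ) * (y₁ : ℤ) ^ 2 = 4)
    (hmin : ∀ u v : ℕ, 0 < u → 0 < v →
      (k : ℤ) * (u : ℤ) ^ 2 - (l : ℤ) * (v : ℤ) ^ 2 = 4 →
      (x₁ : ℝ) * Real.sqrt k + (y₁ : ℝ) * Real.sqrt l ≤
        (u : ℝ) * Real.sqrt k + (v : ℝ) * Real.sqrt l)
    (x y : ℕ) (hx : 0 < x) (hy : 0 < y)
    (hsol : (k : ℤ) * (x : ℤ) ^ 2 - (l : ℤ) * (y : ℤ) ^ 2 = 4) :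
    (∀ (p : ℕ), p.Prime → ¬ p ∣ k → ∀ n : ℕ, 0 < n → ∀ x' : ℕ,
      x = p ^ n * x' → (∀ q : ℕ, q.Prime → q ∣ x' → q ∣ k) →
      ¬ (k = 5 ∧ l = 1 ∧ x = 75025 ∧ y = 167761) →
      (((x : ℝ) * Real.sqrt k + (y : ℝ) * Real.sqrt l) / 2 =
          ((x₁ : ℝ) * Real.sqrt k + (y₁ : ℝ) * Real.sqrt l) / 2 ∨
        ∃ q : ℕ, q.Prime ∧ Odd q ∧ q ≠ p ∧
          ((x : ℝ) * Real.sqrt k + (y : ℝ) * Real.sqrt l) / 2 =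
            (((x₁ : ℝ) * Real.sqrt k + (y₁ : ℝ) * Real.sqrt l) / 2) ^ q)) ∧
    (∀ (p : ℕ), p.Prime → ¬ p ∣ l → ∀ n : ℕ, 0 < n → ∀ y' : ℕ,
      y = p ^ n * y' → (∀ q : ℕ, q.Prime → q ∣ y' → q ∣ l) →
      (((x : ℝ) * Real.sqrt k + (y : ℝ) * Real.sqrt l) / 2 =
          ((x₁ : ℝ) * Real.sqrt k + (y₁ : ℝ) * Real.sqrt l) / 2 ∨
        ∃ q : ℕ, q.Prime ∧ Odd q ∧ q ≠ p ∧
          ((x : ℝ) * Real.sqrt k + (y : ℝ) * Real.sqrt l) / 2 =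
            (((x₁ : ℝ) * Real.sqrt k + (y₁ : ℝ) * Real.sqrt l) / 2) ^ q)) := by
  obtain ⟨oA, oC, bA, bC, j, hj, ex, ey⟩ := stormer_main k l hk hl hok hol hsolvable x₁ y₁ hx₁ hy₁
    hsol₁ hmin x y hx hy hsol
  constructor
  · intro p hp hpk n hn x' hxp hq hexc
    have hc := core 1 (Or.inl rfl) k x₁ (k * x₁^2) (by ring) (Or.inl bA) oA p hp hpk j
      (by rw [← ex, hxp]; exact_mod_cast (dvd_pow_self p hn.ne').mul_right x')
      (by
        intro r hr hrd
        rw [← ex] at hrd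
        have hrd' : r ∣ p ^ n * x' := by rw [← hxp]; exact_mod_cast hrd
        rcases (Nat.Prime.dvd_mul hr).1 hrd' with h | h
        · right; exact (Nat.prime_dvd_prime_iff_eq hr hp).1 (hr.dvd_of_dvd_pow h)
        · left; exact hq r hr h)
    rcases hc with h | h | h
    · left; rw [hj, h]; simp
    · right; exact ⟨2*j+1, h.1, ⟨j, rfl⟩, h.2, hj⟩
    · exfalso
      obtain ⟨hA5, hj12⟩ := h
      have hkx : k * x₁^2 = 5 := by exact_mod_cast hA5
      have hk5 : k = 5 := by
        have hd : k ∣ 5 := ⟨x₁^2, hkx.symm⟩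
        rcases (Nat.dvd_prime (by norm_num)).1 hd with h | h
        · omega
        · exact h
      have hl1 : l * y₁^2 = 1 := by
        have : (l:ℤ) * y₁^2 = 1 := by linarith
        exact_mod_cast this
      have hl1' : l = 1 := Nat.eq_one_of_mul_eq_one_right hl1
      have hx1 : x₁ = 1 := by
        rw [hk5] at hkx
        have : x₁ ^ 2 = 1 := by omega
        simpa using this
      have hval : stR 5 12 = 75025 := by norm_num [stR]
      rw [hA5, hj12, hx1, hval] at ex
      have hx75 : x = 75025 := by omega
      have hy16 : y = 167761 := by
        rw [hk5, hl1', hx75] at hsol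
        have h2 : (y:ℤ)^2 = (167761:ℕ)^2 := by push_cast at hsol ⊢; linarith
        have h3 : y^2 = 167761^2 := by exact_mod_cast h2
        exact Nat.pow_left_injective two_ne_zero h3
      exact hexc ⟨hk5, hl1', hx75, hy16⟩
  · intro p hp hpl n hn y' hyp hq
    have tr : ∀ r : ℕ, (r:ℤ) ∣ y₁ * stR (-1 * (l * y₁^2)) j ↔ r ∣ p ^ n * y' := by
      intro r
      rw [← hyp, ← Int.natCast_dvd_natCast, ey]
      rcases neg_one_pow_eq_or ℤ j with h | h <;> rw [h]
      · rw [one_mul]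
      · generalize stR (-1 * (l * y₁^2)) j = w
        rw [neg_one_mul, mul_neg, dvd_neg]
    have hc := core (-1) (Or.inr rfl) l y₁ (-1 * (l * y₁^2)) rfl (Or.inr bC) oC p hp hpl j
      ((tr p).2 ((dvd_pow_self p hn.ne').mul_right y'))
      (by
        intro r hr hrd
        rcases (Nat.Prime.dvd_mul hr).1 ((tr r).1 hrd) with h | h
        · right; exact (Nat.prime_dvd_prime_iff_eq hr hp).1 (hr.dvd_of_dvd_pow h)
        · left; exact hq r hr h)
    rcases hc with h | h | h
    · left; rw [hj, h]; simp
    · right; exact ⟨2*j+1, h.1, ⟨j, rfl⟩, h.2, hj⟩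
    · exfalso
      have := h.1
      omega
end

section
/- Let D ≠ 2 be a positive nonsquare integer with 8 ∤ D. (i) If 2 ∣ D, then there exists a pair of coprime positive integers (k, l) with k > 1 and kl = D such that k x² − l y² = 1 has a positive integer solution, and this pair (k, l) is unique. (ii) If 2 ∤ D, then exactly one of the following holds, and in that case the witnessing pair (k, l) is unique: either there exist coprime positive integers k, l with k > 1, kl = D such that k x² − l y² = 1 has a positive integer solution, or there exist coprime positive integers k, l with kl = D such that k x² − l y² = 2 has a positive integer solution. (iii) If 2 ∤ D and x² − D y² = 4 has a solution in odd integers x, y, then there exist coprime positive integers k, l with k > 1 and kl = D such that k x² − l y² = 4 has a positive integer solution. -/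
/-- `(k, l)` is a factorization of `D` into coprime positive integers with
`k > 1` for which `k x² - l y² = 1` has a positive integer solution. -/
def SolvOne (D k l : ℕ) : Prop :=
  1 < k ∧ 0 < l ∧ Nat.Coprime k l ∧ k * l = D ∧
    ∃ x y : ℕ, 0 < x ∧ 0 < y ∧ (k : ℤ) * (x : ℤ) ^ 2 - (l : ℤ) * (y : ℤ) ^ 2 = 1

/-- `(k, l)` is a factorization of `D` into coprime positive integers for which
`k x² - l y² = 2` has a positive integer solution. -/
def SolvTwo (D k l : ℕ) : Prop :=
  0 < k ∧ 0 < l ∧ Nat.Coprime k l ∧ k * l = D ∧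
    ∃ x y : ℕ, 0 < x ∧ 0 < y ∧ (k : ℤ) * (x : ℤ) ^ 2 - (l : ℤ) * (y : ℤ) ^ 2 = 2

open Pell

/-- Splitting of `A B = D Y²` with `A`, `B` coprime. -/
lemma split_coprime (A B D Y : ℕ) (hD : 0 < D) (hA : 0 < A) (hB : 0 < B)
    (hc : Nat.Coprime A B) (h : A * B = D * Y ^ 2) :
    ∃ k l x y : ℕ, 0 < k ∧ 0 < l ∧ Nat.Coprime k l ∧ k * l = D ∧ 0 < x ∧ 0 < y ∧
      A = k * x ^ 2 ∧ B = l * y ^ 2 := by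
  have hkl : Nat.gcd D A * Nat.gcd D B = D := by
    rw [← Nat.Coprime.gcd_mul D hc, h]
    exact Nat.gcd_eq_left (Dvd.intro _ rfl)
  obtain ⟨a, ha⟩ := Nat.gcd_dvd_right D A
  obtain ⟨b, hb⟩ := Nat.gcd_dvd_right D B
  have hk : 0 < Nat.gcd D A := Nat.gcd_pos_of_pos_left _ hD
  have hl : 0 < Nat.gcd D B := Nat.gcd_pos_of_pos_left _ hD
  have hckl : Nat.Coprime (Nat.gcd D A) (Nat.gcd D B) :=
    Nat.Coprime.of_dvd (Nat.gcd_dvd_right D A) (Nat.gcd_dvd_right D B) hc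
  generalize Nat.gcd D A = k at *
  generalize Nat.gcd D B = l at *
  have hab : a * b = Y ^ 2 := by
    have : D * (a * b) = D * Y ^ 2 := by
      rw [← h, ha, hb, ← hkl]; ring
    exact Nat.eq_of_mul_eq_mul_left hD this
  have hcab : Nat.Coprime a b :=
    Nat.Coprime.of_dvd (Dvd.intro_left _ ha.symm) (Dvd.intro_left _ hb.symm) hc
  obtain ⟨x, hx⟩ := exists_eq_pow_of_mul_eq_pow (Nat.isUnit_iff.2 hcab) hab
  obtain ⟨y, hy⟩ := exists_eq_pow_of_mul_eq_pow (Nat.isUnit_iff.2 hcab.symm)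
    ((mul_comm b a).trans hab)
  subst hx hy
  refine ⟨k, l, x, y, hk, hl, hckl, hkl, ?_, ?_, ha, hb⟩
  · rcases Nat.eq_zero_or_pos x with h0 | h0
    · subst h0; simp at ha; omega
    · exact h0
  · rcases Nat.eq_zero_or_pos y with h0 | h0
    · subst h0; simp at hb; omega
    · exact h0

/-- Every nonnegative solution is a square or congruent to the fundamental one. -/
lemma pell_cong {d : ℤ} {a : Solution₁ d} (ha : IsFundamental a) (u v : ℤ)
    (h : u ^ 2 - d * v ^ 2 = 1) (hu : 0 < u) (hv : 0 ≤ v) :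
    (∃ p q : ℤ, p ^ 2 - d * q ^ 2 = 1 ∧ u = p ^ 2 + d * q ^ 2 ∧ v = 2 * (p * q)) ∨
    (∃ t s : ℤ, u = a.x + 2 * d * t ∧ v = a.y + 2 * s) := by
  obtain ⟨n, hn⟩ := ha.eq_pow_of_nonneg (a := Solution₁.mk u v h) (by simpa) (by simpa)
  have hx : u = (a ^ n).x := by rw [← hn]; simp
  have hy : v = (a ^ n).y := by rw [← hn]; simp
  rcases Nat.even_or_odd' n with ⟨m, hm | hm⟩
  · left
    refine ⟨(a ^ m).x, (a ^ m).y, (a ^ m).prop, ?_, ?_⟩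
    · rw [hx, hm, two_mul, pow_add, Solution₁.x_mul]; ring
    · rw [hy, hm, two_mul, pow_add, Solution₁.y_mul]; ring
  · right
    have hp := (a ^ m).prop_x
    have e : a ^ n = a ^ m * a ^ m * a := by rw [hm, pow_succ, two_mul, pow_add]
    rw [hx, hy, e]
    simp only [Solution₁.x_mul, Solution₁.y_mul]
    generalize (a ^ m).x = p at *
    generalize (a ^ m).y = q at *
    refine ⟨q ^ 2 * a.x + p * q * a.y, d * q ^ 2 * a.y + p * q * a.x, ?_, ?_⟩
    · linear_combination a.x * hp
    · linear_combination a.y * hp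

lemma solvOne_spec {D k l : ℕ} {a : Solution₁ (D : ℤ)} (ha : IsFundamental a)
    (h : SolvOne D k l) :
    (2 : ℤ) ∣ a.y ∧ Int.gcd (a.x + 1) (2 * D) = 2 * k := by
  obtain ⟨hk, hl, hc, hkl, x, y, hx, hy, e⟩ := h
  have hD : (D : ℤ) = k * l := by rw [← hkl]; push_cast; ring
  have hk' : (1 : ℤ) < k := by exact_mod_cast hk
  have hl' : (0 : ℤ) < l := by exact_mod_cast hl
  have hx' : (0 : ℤ) < x := by exact_mod_cast hx
  have hy' : (0 : ℤ) < y := by exact_mod_cast hy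
  rcases pell_cong ha (k * (x : ℤ) ^ 2 + l * (y : ℤ) ^ 2) (2 * (x * y))
    (by rw [hD]; linear_combination (k * (x : ℤ) ^ 2 - l * (y : ℤ) ^ 2 + 1) * e)
    (by positivity) (by positivity) with ⟨p, q, h1, h2, h3⟩ | ⟨t, s, h2, h3⟩
  · exfalso
    rw [hD] at h1 h2
    have h4 : (l : ℤ) * y ^ 2 = l * (k * q ^ 2) := by linarith
    have h5 := mul_left_cancel₀ hl'.ne' h4
    have h6 : (k : ℤ) ∣ 1 := ⟨x ^ 2 - l * q ^ 2, by
      linear_combination -e - (l : ℤ) * h5⟩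
    have := Int.le_of_dvd one_pos h6
    omega
  · refine ⟨⟨x * y - s, by linarith⟩, ?_⟩
    have h4 : a.x + 1 = 2 * k * ((x : ℤ) ^ 2 - l * t) := by
      linear_combination -h2 - e - 2 * t * hD
    have h5 : (2 * (D : ℤ)) = 2 * k * l := by rw [hD]; ring
    rw [h4, h5, Int.gcd_mul_left]
    have : IsCoprime ((x : ℤ) ^ 2 - l * t) (l : ℤ) :=
      ⟨k, k * t - y ^ 2, by linear_combination e⟩
    rw [Int.isCoprime_iff_gcd_eq_one.1 this]
    simp [Int.natAbs_mul]

lemma solvTwo_spec {D k l : ℕ} {a : Solution₁ (D : ℤ)} (ha : IsFundamental a)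
    (hodd : ¬ 2 ∣ D) (h : SolvTwo D k l) :
    ¬ (2 : ℤ) ∣ a.y ∧ Int.gcd (a.x + 1) D = k := by
  obtain ⟨hk, hl, hc, hkl, x, y, hx, hy, e⟩ := h
  have hD : (D : ℤ) = k * l := by rw [← hkl]; push_cast; ring
  have hk' : (0 : ℤ) < k := by exact_mod_cast hk
  have hl' : (0 : ℤ) < l := by exact_mod_cast hl
  have hx' : (0 : ℤ) < x := by exact_mod_cast hx
  have hy' : (0 : ℤ) < y := by exact_mod_cast hy
  have ok : Odd (k : ℤ) := by
    rw [Int.odd_coe_nat, ← Nat.not_even_iff_odd, even_iff_two_dvd]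
    exact fun h => hodd (hkl ▸ h.mul_right l)
  have ol : Odd (l : ℤ) := by
    rw [Int.odd_coe_nat, ← Nat.not_even_iff_odd, even_iff_two_dvd]
    exact fun h => hodd (hkl ▸ h.mul_left k)
  have oy : Odd (y : ℤ) := by
    rw [← Int.not_even_iff_odd]
    intro hey
    have hex : Even (x : ℤ) := by
      have : Even ((k : ℤ) * x ^ 2) := by
        have h2 : (k : ℤ) * x ^ 2 = 2 + l * y ^ 2 := by linarith
        rw [h2]
        exact even_two.add ((hey.pow_of_ne_zero two_ne_zero).mul_left _)
      rcases Int.even_mul.1 this with h | h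
      · exact absurd h (Int.not_even_iff_odd.2 ok)
      · exact (Int.even_pow.1 h).1
    obtain ⟨r, hr⟩ := hey
    obtain ⟨r', hr'⟩ := hex
    rw [hr, hr'] at e
    have : (4 : ℤ) ∣ 2 := ⟨k * r' ^ 2 - l * r ^ 2, by linear_combination -e⟩
    norm_num at this
  have ox : Odd (x : ℤ) := by
    have : Odd ((k : ℤ) * x ^ 2) := by
      have h2 : (k : ℤ) * x ^ 2 = 2 + l * y ^ 2 := by linarith
      rw [h2]
      exact even_two.add_odd (ol.mul oy.pow)
    exact ((Int.odd_pow' two_ne_zero).1 (Int.odd_mul.1 this).2)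
  rcases pell_cong ha ((l : ℤ) * (y : ℤ) ^ 2 + 1) (x * y)
    (by rw [hD]; linear_combination -(l * (y : ℤ) ^ 2) * e)
    (by positivity) (by positivity) with ⟨p, q, h1, h2, h3⟩ | ⟨t, s, h2, h3⟩
  · exfalso
    have := ox.mul oy
    rw [h3] at this
    exact (Int.not_even_iff_odd.2 this) (even_two_mul _)
  · constructor
    · rintro ⟨r, hr⟩
      have := ox.mul oy
      rw [h3, hr, ← mul_add] at this
      exact (Int.not_even_iff_odd.2 this) (even_two_mul _)
    · have h4 : a.x + 1 = k * ((x : ℤ) ^ 2 - 2 * l * t) := by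
        linear_combination -h2 - e - 2 * t * hD
      rw [h4, hD, Int.gcd_mul_left]
      obtain ⟨r, hr⟩ := ol
      have : IsCoprime ((x : ℤ) ^ 2 - 2 * l * t) (l : ℤ) :=
        ⟨-r * k, 1 - r * (2 * k * t) + r * y ^ 2, by linear_combination (-r) * e + hr⟩
      rw [Int.isCoprime_iff_gcd_eq_one.1 this]
      simp

lemma solvOne_unique {D k l k' l' : ℕ} {a : Solution₁ (D : ℤ)} (ha : IsFundamental a)
    (h : SolvOne D k l) (h' : SolvOne D k' l') : k = k' ∧ l = l' := by
  have h1 := (solvOne_spec ha h).2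
  have h2 := (solvOne_spec ha h').2
  have e : k = k' := by omega
  subst e
  refine ⟨rfl, Nat.eq_of_mul_eq_mul_left (lt_trans one_pos h.1) ?_⟩
  rw [h.2.2.2.1, h'.2.2.2.1]

lemma solvTwo_unique {D k l k' l' : ℕ} {a : Solution₁ (D : ℤ)} (ha : IsFundamental a)
    (hodd : ¬ 2 ∣ D)
    (h : SolvTwo D k l) (h' : SolvTwo D k' l') : k = k' ∧ l = l' := by
  have h1 := (solvTwo_spec ha hodd h).2
  have h2 := (solvTwo_spec ha hodd h').2
  have e : k = k' := by omega
  subst e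
  refine ⟨rfl, Nat.eq_of_mul_eq_mul_left h.1 ?_⟩
  rw [h.2.2.2.1, h'.2.2.2.1]

lemma solvOne_exists {D : ℕ} (hD : 0 < D) {a : Solution₁ (D : ℤ)} (ha : IsFundamental a)
    (h : (2 : ℤ) ∣ a.y) : ∃ k l, SolvOne D k l := by
  obtain ⟨w, hw⟩ := h
  have hp := a.prop
  have h1 := ha.1
  have hox : Odd a.x := by
    have : Odd (a.x ^ 2) := ⟨2 * (D * w ^ 2), by rw [hw] at hp; linear_combination hp⟩
    exact (Int.odd_pow' two_ne_zero).1 this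
  obtain ⟨b, hb⟩ := hox
  have hb0 : 0 < b := by omega
  have hw0 : 0 < w := by have := ha.2.1; omega
  lift b to ℕ using hb0.le
  lift w to ℕ using hw0.le
  obtain ⟨k, l, x, y, hk, hl, hc, hkl, hx, hy, e1, e2⟩ :=
    split_coprime (b + 1) b D w hD (by omega) (by omega) (by simp) (by
      rw [hw, hb] at hp
      have : ((b : ℤ) + 1) * b = D * w ^ 2 := by linarith
      exact_mod_cast this)
  have e : (k : ℤ) * (x : ℤ) ^ 2 - (l : ℤ) * (y : ℤ) ^ 2 = 1 := by
    have e1' : (b : ℤ) + 1 = k * x ^ 2 := by exact_mod_cast e1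
    have e2' : (b : ℤ) = l * y ^ 2 := by exact_mod_cast e2
    linarith
  refine ⟨k, l, ?_, hl, hc, hkl, x, y, hx, hy, e⟩
  by_contra hk1
  have : k = 1 := by omega
  subst this
  have hl' : l = D := by omega
  subst hl'
  have hx1 : 1 < x := by
    by_contra hx1
    have : x = 1 := by omega
    subst this
    simp at e1; omega
  have := ha.x_le_x (a := Solution₁.mk (x : ℤ) y (by simpa using e)) (by simpa using hx1)
  rw [Solution₁.x_mk, hb] at this
  have e1' : (b : ℤ) + 1 = x ^ 2 := by rw [one_mul] at e1; exact_mod_cast e1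
  have hx1' : (1 : ℤ) < x := by exact_mod_cast hx1
  nlinarith

lemma solvTwo_exists {D : ℕ} (hD : 0 < D) {a : Solution₁ (D : ℤ)} (ha : IsFundamental a)
    (hodd : ¬ 2 ∣ D) (h : ¬ (2 : ℤ) ∣ a.y) : ∃ k l, SolvTwo D k l := by
  have hp := a.prop_y
  have h1 := ha.1
  have hy0 := ha.2.1
  have oD : Odd (D : ℤ) := by
    rw [Int.odd_coe_nat, ← Nat.not_even_iff_odd, even_iff_two_dvd]; exact hodd
  have oy : Odd a.y := by rwa [← Int.not_even_iff_odd, even_iff_two_dvd]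
  have hex : Even a.x := by
    have h3 : Odd ((D : ℤ) * a.y ^ 2) := oD.mul oy.pow
    rw [hp] at h3
    by_contra hx
    rw [Int.not_even_iff_odd] at hx
    exact Int.not_even_iff_odd.2 h3 (hx.pow.sub_odd odd_one)
  obtain ⟨b, hb⟩ := hex
  obtain ⟨b, rfl⟩ : ∃ c, b = c + 1 := ⟨b - 1, by ring⟩
  have hb0 : 0 ≤ b := by omega
  generalize a.y = w at *
  lift b to ℕ using hb0
  lift w to ℕ using hy0.le
  obtain ⟨k, l, x, y, hk, hl, hc, hkl, hx, hy, e1, e2⟩ :=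
    split_coprime (2 * b + 3) (2 * b + 1) D w hD (by omega) (by omega) (by
      rw [← Nat.isCoprime_iff_coprime]
      exact ⟨-b, b + 1, by push_cast; ring⟩) (by
      rw [hb] at hp
      have : (2 * (b : ℤ) + 3) * (2 * b + 1) = D * w ^ 2 := by linarith
      exact_mod_cast this)
  refine ⟨k, l, hk, hl, hc, hkl, x, y, hx, hy, ?_⟩
  have e1' : 2 * (b : ℤ) + 3 = k * x ^ 2 := by exact_mod_cast e1
  have e2' : 2 * (b : ℤ) + 1 = l * y ^ 2 := by exact_mod_cast e2
  linarith

lemma fund_y_even {D : ℕ} (he : 2 ∣ D) (h8 : ¬ 8 ∣ D) (a : Solution₁ (D : ℤ)) :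
    (2 : ℤ) ∣ a.y := by
  rw [← even_iff_two_dvd]
  by_contra hy
  rw [Int.not_even_iff_odd] at hy
  have hp := a.prop_y
  have hD : Even (D : ℤ) := by
    rw [Int.even_coe_nat, even_iff_two_dvd]; exact he
  have hox : Odd a.x := by
    have h3 : Even ((D : ℤ) * a.y ^ 2) := hD.mul_right _
    rw [hp] at h3
    by_contra hx
    rw [Int.not_odd_iff_even] at hx
    exact Int.not_even_iff_odd.2 ((hx.pow_of_ne_zero two_ne_zero).sub_odd odd_one) h3
  have h1 : (8 : ℤ) ∣ a.x ^ 2 - 1 := Int.eight_dvd_sq_sub_one_of_odd hox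
  rw [← hp] at h1
  have h2 : IsCoprime (8 : ℤ) (a.y ^ 2) := by
    have : IsCoprime (2 : ℤ) a.y := by
      obtain ⟨r, hr⟩ := hy
      exact ⟨-r, 1, by linarith⟩
    have := this.pow (m := 3) (n := 2)
    norm_num at this
    exact this
  have h3 : (8 : ℤ) ∣ D := h2.dvd_of_dvd_mul_right h1
  exact h8 (by exact_mod_cast h3)

lemma four_exists {D : ℕ} (hD : 0 < D) (n : ℕ) : ∀ m : ℕ, Odd n → Odd m →
    (n : ℤ) ^ 2 - (D : ℤ) * (m : ℤ) ^ 2 = 4 →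
      ∃ k l : ℕ, 1 < k ∧ 0 < l ∧ Nat.Coprime k l ∧ k * l = D ∧
        ∃ x y : ℕ, 0 < x ∧ 0 < y ∧
          (k : ℤ) * (x : ℤ) ^ 2 - (l : ℤ) * (y : ℤ) ^ 2 = 4 := by
  induction n using Nat.strong_induction_on with
  | _ n ih =>
  intro m hn hm h
  have hm0 : 0 < m := hm.pos
  have hn3 : 3 ≤ n := by
    by_contra hlt
    obtain ⟨r, hr⟩ := hn
    have : n = 1 := by omega
    subst this
    have : (0 : ℤ) ≤ D * (m : ℤ) ^ 2 := by positivity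
    push_cast at h
    linarith
  obtain ⟨c, hc⟩ := hn
  obtain ⟨c, rfl⟩ : ∃ d, c = d + 1 := ⟨c - 1, by omega⟩
  have hcop : Nat.Coprime (2 * c + 5) (2 * c + 1) := by
    have h4 : Nat.Coprime (2 * c + 1) 4 := by
      have : Nat.Coprime (2 * c + 1) (2 ^ 2) := Nat.Coprime.pow_right 2 (by simp)
      simpa using this
    have : 2 * c + 5 = 4 + (2 * c + 1) := by ring
    rw [this]
    simpa using h4.symm
  obtain ⟨k, l, x, y, hk, hl, hckl, hkl, hx, hy, e1, e2⟩ :=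
    split_coprime (2 * c + 5) (2 * c + 1) D m hD (by omega) (by omega) hcop (by
      rw [hc] at h
      push_cast at h
      have : (2 * (c : ℤ) + 5) * (2 * c + 1) = D * m ^ 2 := by linarith
      exact_mod_cast this)
  have e1' : 2 * (c : ℤ) + 5 = k * x ^ 2 := by exact_mod_cast e1
  have e2' : 2 * (c : ℤ) + 1 = l * y ^ 2 := by exact_mod_cast e2
  have e : (k : ℤ) * (x : ℤ) ^ 2 - (l : ℤ) * (y : ℤ) ^ 2 = 4 := by linarith
  by_cases hk1 : 1 < k
  · exact ⟨k, l, hk1, hl, hckl, hkl, x, y, hx, hy, e⟩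
  have : k = 1 := by omega
  subst this
  have hl' : l = D := by omega
  subst hl'
  have ox : Odd x := by
    have : Odd (1 * x ^ 2) := e1 ▸ ⟨c + 2, by ring⟩
    rw [one_mul] at this
    exact (Nat.odd_pow_iff two_ne_zero).1 this
  have oy : Odd y := by
    have : Odd (l * y ^ 2) := e2 ▸ ⟨c, rfl⟩
    exact (Nat.odd_pow_iff two_ne_zero).1 (Nat.odd_mul.1 this).2
  refine ih x ?_ y ox oy (by simpa using e)
  by_contra hge
  have : n ≤ x := by omega
  nlinarith

/-- Yuan's generalization of a theorem of Perron on the equations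
`k x² - l y² = 1, 2, 4` with `k l = D`, `D ≠ 2` a positive nonsquare with
`8 ∤ D`. -/
theorem perron_yuan (D : ℕ) (hD : 0 < D) (hD2 : D ≠ 2)
    (hns : ¬ IsSquare D) (h8 : ¬ 8 ∣ D) :
    ((2 ∣ D) → ∃! kl : ℕ × ℕ, SolvOne D kl.1 kl.2) ∧
    (¬ 2 ∣ D →
      (Xor' (∃ k l : ℕ, SolvOne D k l) (∃ k l : ℕ, SolvTwo D k l) ∧
        (∀ k l k' l' : ℕ, SolvOne D k l → SolvOne D k' l' → k = k' ∧ l = l') ∧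
        (∀ k l k' l' : ℕ, SolvTwo D k l → SolvTwo D k' l' → k = k' ∧ l = l'))) ∧
    (¬ 2 ∣ D → (∃ x y : ℤ, Odd x ∧ Odd y ∧ x ^ 2 - (D : ℤ) * y ^ 2 = 4) →
      ∃ k l : ℕ, 1 < k ∧ 0 < l ∧ Nat.Coprime k l ∧ k * l = D ∧
        ∃ x y : ℕ, 0 < x ∧ 0 < y ∧
          (k : ℤ) * (x : ℤ) ^ 2 - (l : ℤ) * (y : ℤ) ^ 2 = 4) := by
  have hD' : (0 : ℤ) < D := by exact_mod_cast hD
  have hns' : ¬ IsSquare (D : ℤ) := by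
    rintro ⟨r, hr⟩
    exact hns ⟨r.natAbs, by zify; rw [hr, abs_mul_abs_self]⟩
  obtain ⟨a, ha⟩ := IsFundamental.exists_of_not_isSquare hD' hns'
  refine ⟨fun he => ?_, fun ho => ⟨?_, ?_, ?_⟩, ?_⟩
  · obtain ⟨k, l, h⟩ := solvOne_exists hD ha (fund_y_even he h8 a)
    refine ⟨(k, l), h, ?_⟩
    rintro ⟨k', l'⟩ h'
    obtain ⟨h1, h2⟩ := solvOne_unique ha h' h
    simp only at h1 h2
    rw [h1, h2]
  · by_cases hy : (2 : ℤ) ∣ a.y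
    · refine Or.inl ⟨solvOne_exists hD ha hy, ?_⟩
      rintro ⟨k, l, h⟩
      exact (solvTwo_spec ha ho h).1 hy
    · refine Or.inr ⟨solvTwo_exists hD ha ho hy, ?_⟩
      rintro ⟨k, l, h⟩
      exact hy (solvOne_spec ha h).1
  · exact fun k l k' l' h h' => solvOne_unique ha h h'
  · exact fun k l k' l' h h' => solvTwo_unique ha ho h h'
  · rintro ho ⟨x, y, hx, hy, e⟩
    exact four_exists hD x.natAbs y.natAbs (Int.natAbs_odd.2 hx) (Int.natAbs_odd.2 hy)
      (by simpa [sq_abs] using e)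
end

section
/- Let D be a positive integer. Then there do not exist four distinct integers n₁, n₂, n₃, n₄ in geometric progression (i.e. there is a nonzero rational r with n₂ = n₁ r, n₃ = n₁ r², n₄ = n₁ r³) such that each nᵢ is of the form D m² + δ for some positive integer m and some δ ∈ {1, −1}. -/
lemma gp_descent_bound (B D x y m k δ ε : ℤ) (hB : 0 < B) (hD : 0 < D) (hx : 0 < x) (hxy : x < y)
    (hm : 0 < m) (hk : 0 ≤ k) (hδ : δ = 1 ∨ δ = -1) (hε : ε = 1 ∨ ε = -1)
    (h1 : B * x ^ 2 = D * m ^ 2 + δ) (h2 : B * y ^ 2 = D * k ^ 2 + ε) :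
    |y * (B * x ^ 2 + D * m ^ 2) - 2 * x * m * k * D| < y := by
  have hsq : x ^ 2 + 3 ≤ y ^ 2 := by nlinarith
  have e1 : D * ((x * k) ^ 2 - (y * m) ^ 2) = δ * y ^ 2 - ε * x ^ 2 := by
    linear_combination y ^ 2 * h1 - x ^ 2 * h2
  have e2 : (D * m * k) ^ 2 - (B * x * y) ^ 2 =
      δ * ε - δ * (B * y ^ 2) - ε * (B * x ^ 2) := by
    linear_combination (-(D * k ^ 2) - ε) * h1 + (-(B * x ^ 2) ) * h2 + δ * h2
      + ε * h1
  have hy : 0 < y := hx.trans hxy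
  have hBsq : B * x ^ 2 + 3 ≤ B * y ^ 2 := by nlinarith
  rw [abs_lt]
  rcases hδ with rfl | rfl
  · have a1 : y * m < x * k := by
      apply lt_of_pow_lt_pow_left₀ 2 (by positivity)
      have : 0 < D * ((x * k) ^ 2 - (y * m) ^ 2) := by
        rw [e1]; rcases hε with rfl | rfl <;> nlinarith
      have := pos_of_mul_pos_right this hD.le
      linarith
    have a2 : D * m * k < B * x * y := by
      apply lt_of_pow_lt_pow_left₀ 2 (by positivity)
      rcases hε with rfl | rfl <;> nlinarith
    constructor
    · nlinarith [mul_lt_mul_of_pos_left a2 hx]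
    · nlinarith [mul_lt_mul_of_pos_left a1 (mul_pos hD hm)]
  · have a1 : x * k < y * m := by
      apply lt_of_pow_lt_pow_left₀ 2 (by positivity)
      have : 0 < D * ((y * m) ^ 2 - (x * k) ^ 2) := by
        have : D * ((y * m) ^ 2 - (x * k) ^ 2) = y ^ 2 + ε * x ^ 2 := by linear_combination -e1
        rw [this]; rcases hε with rfl | rfl <;> nlinarith
      have := pos_of_mul_pos_right this hD.le
      linarith
    have a2 : B * x * y < D * m * k := by
      apply lt_of_pow_lt_pow_left₀ 2 (by positivity)
      rcases hε with rfl | rfl <;> nlinarith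
    constructor
    · nlinarith [mul_lt_mul_of_pos_left a1 (mul_pos hD hm)]
    · nlinarith [mul_lt_mul_of_pos_left a2 hx]

lemma gp_descent (B D : ℤ) (hB : 0 < B) (hD : 0 < D) (N : ℕ) :
    ∀ x y m k δ ε : ℤ, 0 ≤ x → x ≤ y → 0 ≤ m → 0 ≤ k → (δ = 1 ∨ δ = -1) → (ε = 1 ∨ ε = -1) →
    B * x ^ 2 = D * m ^ 2 + δ → B * y ^ 2 = D * k ^ 2 + ε → IsCoprime x y → x + y ≤ N →
    ∃ z η : ℤ, 0 ≤ z ∧ (η = 1 ∨ η = -1) ∧ B = D * z ^ 2 + η := by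
  induction N with
  | zero =>
    intro x y m k δ ε hx hxy hm hk hδ hε h1 h2 hc hN
    have h0 : x = 0 := by push_cast at hN; linarith
    have h0' : y = 0 := by push_cast at hN; linarith
    subst h0 h0'
    exact absurd (isCoprime_self.mp hc) not_isUnit_zero
  | succ N ih =>
    intro x y m k δ ε hx hxy hm hk hδ hε h1 h2 hc hN
    rcases hx.eq_or_lt with rfl | hx
    · have hu : IsUnit y := isCoprime_zero_left.mp hc
      have : y = 1 := by rcases Int.isUnit_iff.mp hu with h | h <;> omega
      subst this
      exact ⟨k, ε, hk, hε, by linarith⟩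
    rcases hxy.eq_or_lt with rfl | hxy
    · have hu : IsUnit x := isCoprime_self.mp hc
      have : x = 1 := by rcases Int.isUnit_iff.mp hu with h | h <;> omega
      subst this
      exact ⟨k, ε, hk, hε, by linarith⟩
    rcases hm.eq_or_lt with rfl | hm
    · have hx1 : x = 1 := by
        by_contra hne
        have : 2 ≤ x := by omega
        rcases hδ with rfl | rfl <;> nlinarith
      subst hx1
      exact ⟨0, δ, le_rfl, hδ, by linarith⟩
    have hb := gp_descent_bound B D x y m k δ ε hB hD hx hxy hm hk hδ hε h1 h2
    set X := y * (B * x ^ 2 + D * m ^ 2) - 2 * x * m * k * D with hX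
    set Z := k * (B * x ^ 2 + D * m ^ 2) - 2 * B * x * y * m with hZ
    have hδ2 : δ ^ 2 = 1 := by rcases hδ with rfl | rfl <;> norm_num
    have hEq : B * |X| ^ 2 = D * |Z| ^ 2 + ε := by
      rw [sq_abs, sq_abs, hX, hZ]
      have hP : (B * x ^ 2 + D * m ^ 2) ^ 2 - 4 * B * D * x ^ 2 * m ^ 2 = 1 := by
        linear_combination (B * x ^ 2 - D * m ^ 2 + δ) * h1 + hδ2
      linear_combination ((B * x ^ 2 + D * m ^ 2) ^ 2 - 4 * B * D * x ^ 2 * m ^ 2) * h2 + ε * hP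
    have hcX : IsCoprime x |X| := by
      have h3 : IsCoprime x (-δ * y + x * (2 * B * x * y - 2 * m * k * D)) := by
        apply IsCoprime.add_mul_left_right
        rcases hδ with rfl | rfl
        · simpa using hc.neg_right
        · simpa using hc
      have h4 : X = -δ * y + x * (2 * B * x * y - 2 * m * k * D) := by
        rw [hX]; linear_combination (-y) * h1
      rw [← h4] at h3
      rcases abs_choice X with h | h <;> rw [h]
      · exact h3
      · exact h3.neg_right
    have hlt : x + |X| ≤ N := by push_cast at hN; linarith
    rcases le_total x |X| with hle | hle
    · exact ih x |X| m |Z| δ ε hx.le hle hm.le (abs_nonneg _) hδ hε h1 hEq hcX hlt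
    · exact ih |X| x |Z| m ε δ (abs_nonneg _) hle (abs_nonneg _) hm.le hε hδ hEq h1 hcX.symm
        (by linarith)

set_option maxHeartbeats 1000000 in
/-- If `B = D z² ± 1` and `B y² = D k² ± 1` with `y ∣ B`, `y > 1`, then `B = y = 2`, `D = 1`. -/
lemma gp_final (B D y z k η ε : ℤ) (hB : 0 < B) (hD : 0 < D) (hy : 1 < y) (hyB : y ∣ B)
    (hz : 0 ≤ z) (hk : 0 ≤ k) (hη : η = 1 ∨ η = -1) (hε : ε = 1 ∨ ε = -1)
    (h1 : B = D * z ^ 2 + η) (h2 : B * y ^ 2 = D * k ^ 2 + ε) : B = 2 ∧ y = 2 ∧ D = 1 := by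
  have hle : y ≤ B := Int.le_of_dvd hB hyB
  have hz : 0 < z := by
    rcases hz.eq_or_lt with rfl | h
    · exfalso; rcases hη with rfl | rfl <;> linarith
    · exact h
  have hDz : 1 ≤ D * z ^ 2 := by have : 0 < D * z ^ 2 := by positivity
                                 linarith
  have hDz' : D * z ≤ D * z ^ 2 := by nlinarith [mul_pos hD hz]
  -- the case `D = 1`, `y = 2 z`
  have key : D = 1 → y = 2 * z → B = 2 ∧ y = 2 ∧ D = 1 := by
    intro hD1 hy2
    have hzB : z ∣ B := (Dvd.intro_left 2 hy2.symm).trans hyB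
    have : z ∣ η := by
      have h := dvd_sub hzB (Dvd.intro_left (D * z) (show D * z * z = D * z ^ 2 by ring))
      rwa [show B - D * z ^ 2 = η by linarith] at h
    have hz1 : z = 1 := by
      have : z ∣ 1 := by rcases hη with rfl | rfl <;> simpa using this
      exact Int.eq_one_of_dvd_one hz.le this
    subst hz1 hD1
    rcases hη with rfl | rfl
    · refine ⟨by linarith, by linarith, rfl⟩
    · linarith
  have e0 : D * k ^ 2 - D * (z * y) ^ 2 = η * y ^ 2 - ε := by
    linear_combination -h2 + y ^ 2 * h1
  have sqD : ∀ T : ℤ, 0 < T → D * T ^ 2 = 1 → D = 1 ∧ T = 1 := by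
    intro T hT h
    have hd : D = 1 := Int.eq_one_of_dvd_one hD.le (Dvd.intro _ h)
    refine ⟨hd, ?_⟩
    subst hd
    nlinarith
  rcases hη with rfl | rfl
  · -- η = 1
    obtain ⟨T, hT⟩ : ∃ T, k = z * y + T := ⟨k - z * y, by ring⟩
    subst hT
    have hTpos : 0 < T := by
      by_contra hn
      have : (z * y + T) ^ 2 ≤ (z * y) ^ 2 := by
        apply pow_le_pow_left₀ hk; linarith
      have := mul_le_mul_of_nonneg_left this hD.le
      rcases hε with rfl | rfl <;> nlinarith
    have e1 : y * (y - 2 * D * z * T) = D * T ^ 2 + ε := by linear_combination -e0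
    have hDT : 1 ≤ D * T ^ 2 := by have : 0 < D * T ^ 2 := by positivity
                                   linarith
    have hk0 : 0 ≤ y - 2 * D * z * T := by
      by_contra hn
      push Not at hn
      have : y * (y - 2 * D * z * T) < 0 := mul_neg_of_pos_of_neg (by linarith) hn
      rcases hε with rfl | rfl <;> linarith
    rcases hk0.eq_or_lt with hk0 | hk0
    · rw [← hk0, mul_zero] at e1
      rcases hε with rfl | rfl
      · linarith
      · obtain ⟨hd, ht⟩ := sqD T hTpos (by linarith)
        subst hd ht
        exact key rfl (by linarith)
    · exfalso
      have h3 : y ≤ D * T ^ 2 + ε := by rw [← e1]; nlinarith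
      have hT2 : 2 * z ≤ T := by
        by_contra hn
        push Not at hn
        have : 0 < D * T := mul_pos hD hTpos
        have : D * T * 1 ≤ D * T * (2 * z - T) := by
          apply mul_le_mul_of_nonneg_left _ this.le; linarith
        rcases hε with rfl | rfl <;> nlinarith
      have : D * z * (2 * z) ≤ D * z * T := mul_le_mul_of_nonneg_left hT2 (mul_pos hD hz).le
      nlinarith
  · -- η = -1
    obtain ⟨T, hT⟩ : ∃ T, k = z * y - T := ⟨z * y - k, by ring⟩
    subst hT
    have hy3 : 4 ≤ y ^ 2 := by nlinarith
    have hTpos : 0 < T := by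
      by_contra hn
      have : (z * y) ^ 2 ≤ (z * y - T) ^ 2 := by
        apply pow_le_pow_left₀ (by positivity); linarith
      have := mul_le_mul_of_nonneg_left this hD.le
      rcases hε with rfl | rfl <;> linarith
    have e1 : y * (2 * D * z * T - y) = D * T ^ 2 + ε := by linear_combination -e0
    have hDT : 1 ≤ D * T ^ 2 := by have : 0 < D * T ^ 2 := by positivity
                                   linarith
    have hT2 : T < 2 * z := by
      by_contra hn
      push Not at hn
      have h3 : (z * y - T) ^ 2 ≤ (z * (y - 2)) ^ 2 := by
        apply pow_le_pow_left₀ hk; linarith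
      have h4 := mul_le_mul_of_nonneg_left h3 hD.le
      have h5 : 4 * (D * z ^ 2) * (y - 1) ≤ y ^ 2 + ε := by nlinarith
      have h6 : (y + 1) * (y - 1) ≤ D * z ^ 2 * (y - 1) := by
        apply mul_le_mul_of_nonneg_right <;> linarith
      rcases hε with rfl | rfl <;> nlinarith
    have hk0 : 0 ≤ 2 * D * z * T - y := by
      by_contra hn
      push Not at hn
      have : y * (2 * D * z * T - y) < 0 := mul_neg_of_pos_of_neg (by linarith) hn
      rcases hε with rfl | rfl <;> linarith
    rcases hk0.eq_or_lt with hk0 | hk0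
    · rw [← hk0, mul_zero] at e1
      rcases hε with rfl | rfl
      · linarith
      · obtain ⟨hd, ht⟩ := sqD T hTpos (by linarith)
        subst hd ht
        exact key rfl (by linarith)
    · exfalso
      have h3 : 0 ≤ (y - 1) * (2 * D * z * T - y - 1) := mul_nonneg (by linarith) (by linarith)
      have h4 : D * (T * (2 * z - T)) ≤ 1 + ε := by linarith
      have hpos : 0 < T * (2 * z - T) := mul_pos hTpos (by linarith)
      rcases hε with rfl | rfl
      · -- `D T (2z - T) ≤ 2` forces `z = 1`, `D ≤ 2`
        have h7 : 1 * (T * (2 * z - T)) ≤ D * (T * (2 * z - T)) :=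
          mul_le_mul_of_nonneg_right (by linarith) hpos.le
        have h8 : D * 1 ≤ D * (T * (2 * z - T)) :=
          mul_le_mul_of_nonneg_left (by linarith) hD.le
        have h9 : 0 ≤ (T - 1) * (2 * z - T - 1) := mul_nonneg (by linarith) (by linarith)
        have h5 : T * (2 * z - T) ≤ 2 := by linarith
        have h6 : 2 * z - 1 ≤ T * (2 * z - T) := by linarith
        have hz1 : z = 1 := by
          have : 2 * z ≤ 3 := by linarith
          omega
        have hD2 : D ≤ 2 := by linarith
        subst hz1
        linarith
      · linarith [mul_pos hD hpos]

lemma gp_main (D : ℤ) (hD : 0 < D) (a x y m₁ m₂ m₄ δ₁ δ₂ δ₄ : ℤ) (ha : 0 < a) (hx : 0 < x)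
    (hxy : x < y) (hc : IsCoprime x y) (hm₁ : 0 < m₁) (hm₂ : 0 < m₂) (hm₄ : 0 < m₄)
    (hδ₁ : δ₁ = 1 ∨ δ₁ = -1) (hδ₂ : δ₂ = 1 ∨ δ₂ = -1) (hδ₄ : δ₄ = 1 ∨ δ₄ = -1)
    (h₁ : a * x ^ 3 = D * m₁ ^ 2 + δ₁) (h₂ : a * x ^ 2 * y = D * m₂ ^ 2 + δ₂)
    (h₄ : a * y ^ 3 = D * m₄ ^ 2 + δ₄) : False := by
  have hy : 0 < y := hx.trans hxy
  have hB : 0 < a * y := mul_pos ha hy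
  have e2 : (a * y) * x ^ 2 = D * m₂ ^ 2 + δ₂ := by linarith
  have e4 : (a * y) * y ^ 2 = D * m₄ ^ 2 + δ₄ := by linarith
  obtain ⟨z, η, hz, hη, hBz⟩ := gp_descent (a * y) D hB hD (x + y).toNat x y m₂ m₄ δ₂ δ₄ hx.le
    hxy.le hm₂.le hm₄.le hδ₂ hδ₄ e2 e4 hc (Int.self_le_toNat _)
  obtain ⟨hB2, hy2, hD1⟩ := gp_final (a * y) D y z m₄ η δ₄ hB hD (by linarith)
    (Dvd.intro_left a rfl) hz hm₄.le hη hδ₄ hBz e4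
  subst hy2 hD1
  have ha1 : a = 1 := by linarith
  have hx1 : x = 1 := by linarith
  subst ha1 hx1
  rcases hδ₁ with rfl | rfl
  · nlinarith
  · have : m₁ ^ 2 = 2 := by linarith
    have : m₁ < 2 := by nlinarith
    have : m₁ = 1 := by linarith
    subst this
    norm_num at *

/-- Increasing case. -/
lemma gp_incr (D : ℤ) (hD : 0 < D) (n₁ n₂ n₄ : ℤ) (r : ℚ) (hn : 0 < n₁) (hr : 1 < r)
    (h₂ : (n₂ : ℚ) = n₁ * r) (h₄ : (n₄ : ℚ) = n₁ * r ^ 3)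
    (m₁ m₂ m₄ δ₁ δ₂ δ₄ : ℤ) (hm₁ : 0 < m₁) (hm₂ : 0 < m₂) (hm₄ : 0 < m₄)
    (hδ₁ : δ₁ = 1 ∨ δ₁ = -1) (hδ₂ : δ₂ = 1 ∨ δ₂ = -1) (hδ₄ : δ₄ = 1 ∨ δ₄ = -1)
    (e₁ : n₁ = D * m₁ ^ 2 + δ₁) (e₂ : n₂ = D * m₂ ^ 2 + δ₂) (e₄ : n₄ = D * m₄ ^ 2 + δ₄) :
    False := by
  obtain ⟨y, hy⟩ : ∃ y : ℤ, y = r.num := ⟨_, rfl⟩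
  obtain ⟨x, hx⟩ : ∃ x : ℤ, x = (r.den : ℤ) := ⟨_, rfl⟩
  have hx0 : 0 < x := by rw [hx]; exact_mod_cast r.den_pos
  have hxq : (0 : ℚ) < x := by exact_mod_cast hx0
  have hrq : r = (y : ℚ) / x := by
    rw [hx, hy]; push_cast; exact (Rat.num_div_den r).symm
  have hc : IsCoprime x y := by
    rw [hx, hy]; exact (Rat.isCoprime_num_den r).symm
  have hxy : x < y := by
    rw [hrq, lt_div_iff₀ hxq, one_mul] at hr
    exact_mod_cast hr
  have f4 : n₄ * x ^ 3 = n₁ * y ^ 3 := by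
    have : (n₄ : ℚ) * x ^ 3 = n₁ * y ^ 3 := by rw [h₄, hrq]; field_simp
    exact_mod_cast this
  have f2 : n₂ * x = n₁ * y := by
    have : (n₂ : ℚ) * x = n₁ * y := by rw [h₂, hrq]; field_simp
    exact_mod_cast this
  have hdvd : x ^ 3 ∣ n₁ :=
    (hc.pow (m := 3) (n := 3)).dvd_of_dvd_mul_right (Dvd.intro_left n₄ f4)
  obtain ⟨a, ha⟩ := hdvd
  have hx3 : 0 < x ^ 3 := by positivity
  have ha0 : 0 < a := by
    rw [ha] at hn; exact pos_of_mul_pos_right hn hx3.le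
  refine gp_main D hD a x y m₁ m₂ m₄ δ₁ δ₂ δ₄ ha0 hx0 hxy hc hm₁ hm₂ hm₄ hδ₁ hδ₂ hδ₄
    (by rw [← e₁, ha]; ring) ?_ ?_
  · rw [← e₂]
    apply mul_right_cancel₀ hx0.ne'
    rw [f2, ha]; ring
  · rw [← e₄]
    apply mul_right_cancel₀ hx3.ne'
    rw [f4, ha]; ring

/-- No geometric progression contains four distinct integers of the form
`D m² ± 1` with `m` a positive integer (`D` a fixed positive integer). -/
theorem no_four_in_geometric_progression (D : ℕ) (hD : 0 < D) :
    ¬ ∃ (n₁ n₂ n₃ n₄ : ℤ) (r : ℚ), n₁ ≠ 0 ∧ r ≠ 0 ∧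
      (n₂ : ℚ) = (n₁ : ℚ) * r ∧ (n₃ : ℚ) = (n₁ : ℚ) * r ^ 2 ∧
      (n₄ : ℚ) = (n₁ : ℚ) * r ^ 3 ∧
      n₁ ≠ n₂ ∧ n₁ ≠ n₃ ∧ n₁ ≠ n₄ ∧ n₂ ≠ n₃ ∧ n₂ ≠ n₄ ∧ n₃ ≠ n₄ ∧
      (∀ n ∈ ({n₁, n₂, n₃, n₄} : Set ℤ),
        ∃ (m : ℕ) (δ : ℤ), 0 < m ∧ (δ = 1 ∨ δ = -1) ∧
          n = (D : ℤ) * (m : ℤ) ^ 2 + δ) := by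
  rintro ⟨n₁, n₂, n₃, n₄, r, hn, hr, h₂, h₃, h₄, d12, -, -, -, -, -, H⟩
  have hD' : (0 : ℤ) < D := by exact_mod_cast hD
  obtain ⟨m₁, δ₁, hm₁, hδ₁, e₁⟩ := H n₁ (by simp)
  obtain ⟨m₂, δ₂, hm₂, hδ₂, e₂⟩ := H n₂ (by simp)
  obtain ⟨m₃, δ₃, hm₃, hδ₃, e₃⟩ := H n₃ (by simp)
  obtain ⟨m₄, δ₄, hm₄, hδ₄, e₄⟩ := H n₄ (by simp)
  have nonneg : ∀ (m : ℕ) (δ : ℤ), 0 < m → (δ = 1 ∨ δ = -1) → 0 ≤ (D : ℤ) * (m : ℤ) ^ 2 + δ := by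
    intro m δ hm hδ
    have : 0 < (D : ℤ) * (m : ℤ) ^ 2 := by positivity
    rcases hδ with rfl | rfl <;> linarith
  have p₁ : 0 < n₁ := lt_of_le_of_ne (e₁ ▸ nonneg m₁ δ₁ hm₁ hδ₁) hn.symm
  have q₂ : 0 ≤ n₂ := e₂ ▸ nonneg m₂ δ₂ hm₂ hδ₂
  have p₁q : (0 : ℚ) < n₁ := by exact_mod_cast p₁
  have q₂q : (0 : ℚ) ≤ n₂ := by exact_mod_cast q₂
  have hr0 : 0 < r := by
    apply lt_of_le_of_ne _ hr.symm
    rw [h₂] at q₂q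
    exact nonneg_of_mul_nonneg_right q₂q p₁q
  have hm₁' : (0 : ℤ) < m₁ := by exact_mod_cast hm₁
  have hm₂' : (0 : ℤ) < m₂ := by exact_mod_cast hm₂
  have hm₃' : (0 : ℤ) < m₃ := by exact_mod_cast hm₃
  have hm₄' : (0 : ℤ) < m₄ := by exact_mod_cast hm₄
  rcases lt_trichotomy r 1 with h | h | h
  · have p₄ : 0 < n₄ := by
      have : (0 : ℚ) < n₄ := by rw [h₄]; positivity
      exact_mod_cast this
    refine gp_incr D hD' n₄ n₃ n₁ r⁻¹ p₄ ((one_lt_inv₀ hr0).mpr h) ?_ ?_ m₄ m₃ m₁ δ₄ δ₃ δ₁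
      hm₄' hm₃' hm₁' hδ₄ hδ₃ hδ₁ e₄ e₃ e₁
    · rw [h₃, h₄]; field_simp
    · rw [h₄]; field_simp
  · subst h
    apply d12
    have : (n₁ : ℚ) = n₂ := by rw [h₂]; ring
    exact_mod_cast this
  · exact gp_incr D hD' n₁ n₂ n₄ r p₁ h h₂ h₄ m₁ m₂ m₄ δ₁ δ₂ δ₄ hm₁' hm₂' hm₄' hδ₁ hδ₂ hδ₄ e₁ e₂ e₄
end

section
/- Let p be an odd prime, let s, a, b be positive integers with a ≥ b, let k₁, …, k_s be odd integers each greater than 1, let t₁, …, t_s be positive integers and r₁, …, r_s nonnegative integers with tᵢ > rᵢ for every i, and let δ ∈ {4, −4}. Suppose x, y are positive integers with y odd satisfying x² = p^{2a} k₁^{2t₁} ⋯ k_s^{2t_s} y² − δ p^{a+b} k₁^{t₁+r₁} ⋯ k_s^{t_s+r_s} + 4. Then, except for the single case (x, y, p, s, r₁, t₁, k₁, a, b, δ) = (123, 1, 11, 1, 1, 2, 5, 1, 1, 4), one of the following holds: (A) p ∣ y, x = p^{a+b} k₁^{t₁+r₁} ⋯ k_s^{t_s+r_s} − δ/2, and y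 = p^{b} k₁^{r₁} ⋯ k_s^{r_s}; or (B) p ∤ y, p^{b} = k₁^{t₁+r₁} ⋯ k_s^{t_s+r_s} − δ/2, x = p^{2b} − 2, y = k₁^{r₁} ⋯ k_s^{r_s}, and a = b. -/
/-- Lucas sequence with parameters `(k, 1)`. -/
def lucU (k : ℤ) : ℕ → ℤ
  | 0 => 0
  | 1 => 1
  | (n+2) => k * lucU k (n+1) - lucU k n

/-- Companion Lucas sequence. -/
def lucV (k : ℤ) (n : ℕ) : ℤ := 2 * lucU k (n+1) - k * lucU k n

theorem lucU_rec (k : ℤ) (n : ℕ) : lucU k (n+2) = k * lucU k (n+1) - lucU k n := by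
  simp [lucU]

theorem lucU_zero (k : ℤ) : lucU k 0 = 0 := by simp [lucU]
theorem lucU_one (k : ℤ) : lucU k 1 = 1 := by simp [lucU]

theorem lucU_inv (k : ℤ) (n : ℕ) :
    lucU k (n+1) ^ 2 - k * lucU k (n+1) * lucU k n + lucU k n ^ 2 = 1 := by
  induction n with
  | zero => simp [lucU]
  | succ n ih => rw [lucU_rec]; linear_combination ih

theorem lucV_sq (k : ℤ) (n : ℕ) : lucV k n ^ 2 - 4 = (k^2-4) * lucU k n ^ 2 := by
  unfold lucV; linear_combination 4 * lucU_inv k n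

theorem lucU_add (k : ℤ) (c l : ℕ) :
    lucU k (c+l) = lucU k l * lucU k (c+1) - lucU k c * (k * lucU k l - lucU k (l+1)) ∧
    lucU k (c+l+1) = lucU k (c+1) * lucU k (l+1) - lucU k c * lucU k l := by
  induction l with
  | zero => simp [lucU]
  | succ l ih =>
    obtain ⟨h1, h2⟩ := ih
    have e1 : lucU k (c+(l+1)+1) = k * lucU k (c+l+1) - lucU k (c+l) := lucU_rec k (c+l)
    have e2 : lucU k (l+1+1) = k * lucU k (l+1) - lucU k l := lucU_rec k l
    refine ⟨?_, ?_⟩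
    · rw [← add_assoc, h2, e2]; ring
    · rw [e1, h1, h2, e2]; ring

theorem lucU_two_step (k : ℤ) (c l : ℕ) :
    lucU k (c+l+l) = lucV k l * lucU k (c+l) - lucU k c := by
  obtain ⟨h1, h2⟩ := lucU_add k c l
  obtain ⟨h3, -⟩ := lucU_add k (c+l) l
  rw [h3, h2, h1]; unfold lucV
  linear_combination (-lucU k c) * lucU_inv k l

theorem lucU_mul (k : ℤ) (l j : ℕ) :
    lucU k (l*j) = lucU k l * lucU (lucV k l) j ∧
    lucU k (l*(j+1)) = lucU k l * lucU (lucV k l) (j+1) := by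
  induction j with
  | zero => simp [lucU]
  | succ j ih =>
    refine ⟨ih.2, ?_⟩
    have e : l*(j+1+1) = l*j+l+l := by ring
    have e' : l*(j+1) = l*j+l := by ring
    rw [e, lucU_two_step, ← e', ih.1, ih.2, lucU_rec]; ring

theorem lucU_double (k : ℤ) (m : ℕ) : lucU k (m+m) = lucU k m * lucV k m := by
  have := lucU_two_step k 0 m
  simp [lucU_zero] at this
  rw [this]; ring

theorem lucU_odd (k : ℤ) (m : ℕ) :
    lucU k (m+m+1) = (lucU k (m+1) - lucU k m) * (lucU k (m+1) + lucU k m) := by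
  rw [(lucU_add k m m).2]; ring

theorem lucU_exp (E : ℤ) (j : ℕ) :
    E^2 ∣ 6 * lucU (2+E) j - 6 * j - j * (j^2-1) * E ∧
    E^2 ∣ 6 * lucU (2+E) (j+1) - 6 * (j+1:ℕ) - (j+1:ℕ) * ((j+1:ℕ)^2-1) * E := by
  induction j with
  | zero => simp [lucU]
  | succ j ih =>
    refine ⟨ih.2, ?_⟩
    obtain ⟨⟨u, hu⟩, ⟨v, hv⟩⟩ := ih
    refine ⟨(2+E)*v - u + (j+1)*((j+1)^2-1), ?_⟩
    rw [lucU_rec]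
    push_cast at *
    linear_combination (2+E)*hv - hu

theorem lucU_lin (E : ℤ) (j : ℕ) :
    E ∣ lucU (2+E) j - j ∧ E ∣ lucU (2+E) (j+1) - (j+1:ℕ) := by
  induction j with
  | zero => simp [lucU]
  | succ j ih =>
    refine ⟨ih.2, ?_⟩
    obtain ⟨⟨u, hu⟩, ⟨v, hv⟩⟩ := ih
    refine ⟨(2+E)*v - u + (j+1), ?_⟩
    rw [lucU_rec]
    push_cast at *
    linear_combination (2+E)*hv - hu

theorem lucU_neg (k : ℤ) (n : ℕ) :
    lucU (-k) n = (-1)^(n+1) * lucU k n ∧ lucU (-k) (n+1) = (-1)^(n+2) * lucU k (n+1) := by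
  induction n with
  | zero => simp [lucU]
  | succ n ih =>
    refine ⟨ih.2, ?_⟩
    rw [lucU_rec, lucU_rec, ih.1, ih.2]; ring

theorem lucU_neg_dvd (k d : ℤ) (n : ℕ) : d ∣ lucU (-k) n ↔ d ∣ lucU k n := by
  rw [(lucU_neg k n).1]
  rcases neg_one_pow_eq_or ℤ (n+1) with h | h <;> simp [h]

theorem lucU_dvd_index (q : ℕ) (hq : q.Prime) (k : ℤ) (hk : (q:ℤ) ∣ k^2-4) (n : ℕ)
    (h : (q:ℤ) ∣ lucU k n) : q ∣ n := by
  have hq' : Prime (q:ℤ) := Nat.prime_iff_prime_int.mp hq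
  have key : ∀ k : ℤ, (q:ℤ) ∣ k - 2 → (q:ℤ) ∣ lucU k n → q ∣ n := by
    intro k hk h
    have := (lucU_lin (k-2) n).1
    rw [show 2 + (k-2) = k by ring] at this
    have h2 := dvd_sub h (hk.trans this)
    simp at h2
    exact_mod_cast h2
  have : (q:ℤ) ∣ (k-2)*(k+2) := by convert hk using 1; ring
  rcases hq'.dvd_or_dvd this with h1 | h1
  · exact key k h1 h
  · refine key (-k) ?_ ((lucU_neg_dvd k q n).2 h)
    rw [show -k - 2 = -(k+2) by ring]
    exact (dvd_neg (a := (q:ℤ))).2 h1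

theorem lucU_not_sq (q : ℕ) (hq : q.Prime) (h5 : 5 ≤ q) (k : ℤ) (hk : (q:ℤ) ∣ k^2-4) :
    ¬ (q:ℤ)^2 ∣ lucU k q := by
  have hq' : Prime (q:ℤ) := Nat.prime_iff_prime_int.mp hq
  have key : ∀ k : ℤ, (q:ℤ) ∣ k - 2 → ¬ (q:ℤ)^2 ∣ lucU k q := by
    intro k hk h
    have := (lucU_exp (k-2) q).1
    rw [show 2 + (k-2) = k by ring] at this
    have h1 : (q:ℤ)^2 ∣ (k-2)^2 := pow_dvd_pow_of_dvd hk 2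
    have h2 := h1.trans this
    obtain ⟨c, hc⟩ := hk
    obtain ⟨u, hu⟩ := h
    obtain ⟨v, hv⟩ := h2
    have h3 : (q:ℤ)^2 ∣ q * 6 := ⟨6*u - v - (q^2-1)*c, by
      rw [hu, hc] at hv
      linear_combination -hv⟩
    rw [pow_two] at h3
    have h4 := (mul_dvd_mul_iff_left hq'.ne_zero).1 h3
    have h6 : q ∣ 6 := by exact_mod_cast h4
    have := Nat.le_of_dvd (by norm_num) h6
    interval_cases q
    · omega
    · exact absurd hq (by norm_num)
  have : (q:ℤ) ∣ (k-2)*(k+2) := by convert hk using 1; ring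
  rcases hq'.dvd_or_dvd this with h1 | h1
  · exact key k h1
  · rw [← lucU_neg_dvd]
    refine key (-k) ?_
    rw [show -k - 2 = -(k+2) by ring]
    exact (dvd_neg (a := (q:ℤ))).2 h1

theorem lucU_lte (q : ℕ) (hq : q.Prime) (h5 : 5 ≤ q) (k : ℤ) (hk : (q:ℤ) ∣ k^2-4) (j : ℕ) :
    ∀ n : ℕ, (q:ℤ)^j ∣ lucU k n → q^j ∣ n := by
  have hq' : Prime (q:ℤ) := Nat.prime_iff_prime_int.mp hq
  induction j with
  | zero => simp
  | succ j ih =>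
    intro n h
    have h1 : q ∣ n := lucU_dvd_index q hq k hk n ((dvd_pow_self _ (by omega)).trans h)
    obtain ⟨l, rfl⟩ := h1
    rw [mul_comm q l, (lucU_mul k l q).1] at h
    have hV : (q:ℤ) ∣ lucV k l ^ 2 - 4 := by rw [lucV_sq]; exact hk.mul_right _
    have hn := lucU_not_sq q hq h5 _ hV
    have hj : (q:ℤ)^j ∣ lucU k l := by
      by_contra hcon
      by_cases hd : (q:ℤ) ∣ lucU (lucV k l) q
      · obtain ⟨c, hc⟩ := hd
        have hc' : ¬ (q:ℤ) ∣ c := by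
          rintro ⟨e, rfl⟩
          exact hn ⟨e, by rw [hc]; ring⟩
        rw [hc, pow_succ, show lucU k l * (q * c) = (lucU k l * c) * q by ring] at h
        have h2 := (mul_dvd_mul_iff_right hq'.ne_zero).1 h
        exact hcon (hq'.pow_dvd_of_dvd_mul_right j hc' h2)
      · have h2 := hq'.pow_dvd_of_dvd_mul_right (j+1) hd h
        exact hcon ((pow_dvd_pow _ (by omega)).trans h2)
    have := ih l hj
    rw [pow_succ, mul_comm]
    exact mul_dvd_mul_left q this

theorem lucU_even (k : ℤ) (hk : Odd k) (n : ℕ) (h : Odd (lucU k n)) : ¬ 3 ∣ n := by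
  rintro ⟨m, rfl⟩
  rw [(lucU_mul k 3 m).1] at h
  have h3 := (Int.odd_mul.1 h).1
  have : lucU k 3 = k * k - 1 := by simp [lucU]
  rw [this] at h3
  have := hk.mul hk
  exact absurd (this.sub_odd (odd_one)) (Int.not_even_iff_odd.2 h3)

theorem lucU_growth (k : ℤ) (hk : 3 ≤ k) (n : ℕ) :
    0 ≤ lucU k n ∧ 2 * lucU k n + 1 ≤ lucU k (n+1) := by
  induction n with
  | zero => simp [lucU]
  | succ n ih =>
    obtain ⟨h1, h2⟩ := ih
    refine ⟨by linarith, ?_⟩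
    rw [lucU_rec]
    nlinarith

theorem lucU_gt (k : ℤ) (hk : 3 ≤ k) (n : ℕ) : (n:ℤ) + 3 ≤ lucU k (n+2) + 0 := by
  induction n with
  | zero => simp [lucU]; linarith
  | succ n ih =>
    have := lucU_growth k hk (n+2)
    have e : n + 1 + 2 = n + 2 + 1 := by ring
    rw [e]
    push_cast
    linarith

theorem lucA_growth (k : ℤ) (hk : 3 ≤ k) (n : ℕ) :
    2 * n + 8 ≤ lucU k (n+4) - lucU k (n+3) := by
  have h3 : 8 ≤ lucU k 3 := by simp [lucU]; nlinarith
  have hge : ∀ n : ℕ, 8 + 2 * (n:ℤ) ≤ lucU k (n+3) := by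
    intro n
    induction n with
    | zero => simpa using h3
    | succ n ih =>
      have := lucU_growth k hk (n+3)
      have e : n + 1 + 3 = n + 3 + 1 := by ring
      rw [e]; push_cast; linarith
  have := hge n
  have := lucU_growth k hk (n+3)
  have e : n + 4 = n + 3 + 1 := by ring
  rw [e]; linarith

/-- odd-order divisors supported on primes of `k^2-4` divide the index -/
theorem luc_dvd (k : ℤ) (hk : Odd k) (n : ℕ) (hodd : Odd (lucU k n)) (F : ℤ) (hF : 0 < F)
    (hd : F ∣ lucU k n) (hp : ∀ q : ℕ, q.Prime → (q:ℤ) ∣ F → (q:ℤ) ∣ k^2-4) : F ∣ n := by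
  lift F to ℕ using hF.le
  rw [Int.natCast_dvd_natCast]
  rw [Nat.dvd_iff_prime_pow_dvd_dvd]
  intro q j hq hj
  rcases Nat.eq_zero_or_pos j with rfl | hj0
  · simp
  have h1 : (q:ℤ)^j ∣ F := by exact_mod_cast hj
  have hqF : (q:ℤ) ∣ F := (dvd_pow_self _ (by omega)).trans h1
  have hk4 := hp q hq hqF
  have hqn := lucU_dvd_index q hq k hk4 n (hqF.trans hd)
  have hn3 := lucU_even k hk n hodd
  have h2 : q ≠ 2 := by
    rintro rfl
    have := hqF.trans hd
    exact absurd (even_iff_two_dvd.2 (by exact_mod_cast this)) (Int.not_even_iff_odd.2 hodd)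
  have h3 : q ≠ 3 := by rintro rfl; exact hn3 hqn
  have h4 : q ≠ 4 := by rintro rfl; exact absurd hq (by norm_num)
  have := hq.two_le
  exact lucU_lte q hq (by omega) k hk4 j n (h1.trans hd)

theorem luc_descent (k y : ℤ) (hy : 0 < y) (hk : y^2 ≤ k) (m : ℕ) :
    ∀ N w : ℤ, 0 ≤ w → w < N → w ≤ m → N^2 + w^2 - k*N*w = y^2 →
      ∃ n : ℕ, N = y * lucU k (n+1) ∧ w = y * lucU k n := by
  induction m with
  | zero =>
    intro N w h0 h1 h2 h
    have hw : w = 0 := by simp at h2; omega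
    subst hw
    refine ⟨0, ?_, by simp [lucU]⟩
    simp [lucU]
    nlinarith
  | succ m ih =>
    intro N w h0 h1 h2 h
    rcases h0.eq_or_lt with h0 | h0
    · exact ih N w (by omega) h1 (by omega) h
    have e : (k*w - N) * N = w^2 - y^2 := by linear_combination -h
    have hlt : k*w - N < w := by
      by_contra hc
      push Not at hc
      nlinarith
    have hge : 0 ≤ k*w - N := by
      by_contra hc
      push Not at hc
      have e2 : (k*w - N)^2 + w^2 - k*(k*w-N)*w = y^2 := by linear_combination h
      have h5 : 0 < k := by nlinarith
      have h6 : 1 ≤ -(k*w-N) * w := by nlinarith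
      nlinarith [mul_le_mul_of_nonneg_left h6 h5.le]
    obtain ⟨n, hn1, hn2⟩ := ih w (k*w-N) hge hlt (by push_cast at h2; omega) (by linear_combination h)
    refine ⟨n+1, ?_, hn1⟩
    rw [lucU_rec]
    linear_combination k * hn1 - hn2

theorem luc_core2 (p : ℕ) (hp : p.Prime) (hpodd : Odd p) (b c : ℕ) (hb : 0 < b)
    (R Q : ℤ) (hR0 : 0 < R) (hQ : 3 ≤ Q) (hRo : Odd R) (hQo : Odd Q)
    (hRQ : ∀ q : ℕ, q.Prime → (q:ℤ) ∣ R → (q:ℤ) ∣ Q)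
    (σ : ℤ) (hσ : σ = 1 ∨ σ = -1) (y : ℤ) (hy : 0 < y) (hyodd : Odd y)
    (N D k : ℤ) (hN : N = (p:ℤ)^b * R) (hD : D = (p:ℤ)^c * Q) (hk : k = D*y^2 - 2*σ)
    (hk3 : 3 ≤ k) (n : ℕ) (hn : N = y * lucU k (n+1)) :
    y = N ∨ (¬ (p:ℤ) ∣ y ∧ (p:ℤ)^b = R*Q*R - 2*σ ∧ y = R ∧ c = 0) ∨
      (y = 1 ∧ D = 5 ∧ N = 55 ∧ σ = 1) := by
  have hp' : Prime (p:ℤ) := Nat.prime_iff_prime_int.mp hp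
  have hpo : Odd (p:ℤ) := by exact_mod_cast hpodd
  have hNo : Odd N := by rw [hN]; exact (hpo.pow).mul hRo
  have hDo : Odd D := by rw [hD]; exact (hpo.pow).mul hQo
  have hσ2 : σ^2 = 1 := by rcases hσ with rfl | rfl <;> norm_num
  have hko : Odd k := by
    rw [hk]; exact (hDo.mul hyodd.pow).sub_even ⟨σ, by ring⟩
  have hUo : Odd (lucU k (n+1)) := by rw [hn] at hNo; exact (Int.odd_mul.1 hNo).2
  have hk4 : k^2 - 4 = D * (D*y^4 - 4*σ*y^2) := by
    rw [hk]; linear_combination 4 * hσ2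
  have hD4 : ∀ q : ℤ, q ∣ D → q ∣ k^2 - 4 := fun q h => by rw [hk4]; exact h.mul_right _
  have hRD : ∀ q : ℕ, q.Prime → (q:ℤ) ∣ R → (q:ℤ) ∣ D := fun q hq h => by
    rw [hD]; exact (hRQ q hq h).mul_left _
  have hUN : lucU k (n+1) ∣ N := ⟨y, by rw [hn]; ring⟩
  -- a divisor coprime to `p` divides `R`
  have hcop : ∀ F : ℤ, F ∣ lucU k (n+1) → ¬ (p:ℤ) ∣ F → F ∣ R := by
    intro F h1 h2
    have h3 := h1.trans hUN
    rw [hN] at h3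
    have h4 : IsCoprime F ((p:ℤ)^b) := ((hp'.coprime_iff_not_dvd.2 h2).symm).pow_right
    exact h4.dvd_of_dvd_mul_left h3
  have hno2 : ∀ q : ℕ, q.Prime → (q:ℤ) ∣ N → ¬ (q:ℤ) ∣ 2 := by
    intro q hq h1 h2
    have : q ∣ 2 := by exact_mod_cast h2
    have := (Nat.prime_dvd_prime_iff_eq hq Nat.prime_two).1 this
    subst this
    exact absurd (even_iff_two_dvd.2 (by exact_mod_cast h1)) (Int.not_even_iff_odd.2 hNo)
  have hno4 : ∀ q : ℕ, q.Prime → (q:ℤ) ∣ N → ¬ (q:ℤ) ∣ 4 := by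
    intro q hq h1 h2
    have hq' : Prime (q:ℤ) := Nat.prime_iff_prime_int.mp hq
    exact hno2 q hq h1 (hq'.dvd_of_dvd_pow (n := 2) (by norm_num; exact h2))
  rcases Nat.even_or_odd (n+1) with ⟨m, hm⟩ | ⟨m, hm⟩
  · -- even index
    right; left
    rw [hm] at hn hUo hUN hcop
    have hdb := lucU_double k m
    have hVN : lucV k m ∣ N := by
      refine Dvd.dvd.trans ?_ hUN
      rw [hdb]; exact dvd_mul_left _ _
    have hVp : ∀ q : ℕ, q.Prime → (q:ℤ) ∣ lucV k m → q = p ∧ ¬ (q:ℤ) ∣ D := by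
      intro q hq h
      have hq' : Prime (q:ℤ) := Nat.prime_iff_prime_int.mp hq
      have hqN := h.trans hVN
      have hnD : ¬ (q:ℤ) ∣ D := by
        intro hqD
        have h1 : (q:ℤ) ∣ (k^2-4) * lucU k m ^ 2 := (hD4 _ hqD).mul_right _
        rw [← lucV_sq] at h1
        have h2 : (q:ℤ) ∣ lucV k m ^ 2 := dvd_pow h (by norm_num)
        have h3 := dvd_sub h2 h1
        simp at h3
        exact hno4 q hq hqN h3
      refine ⟨?_, hnD⟩
      rw [hN] at hqN
      rcases hq'.dvd_or_dvd hqN with h1 | h1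
      · have h2 := hq'.dvd_of_dvd_pow h1
        exact (Nat.prime_dvd_prime_iff_eq hq hp).1 (by exact_mod_cast h2)
      · exact absurd (hRD q hq h1) hnD
    rcases Nat.lt_or_ge m 2 with hm2 | hm2
    · have hm1 : m = 1 := by omega
      subst hm1
      have hV1 : lucV k 1 = k := by simp [lucV, lucU]; ring
      have hU2 : lucU k (1+1) = k := by simp [lucU]
      rw [hU2] at hn
      rw [hV1] at hVp
      obtain ⟨κ, rfl⟩ : ∃ κ : ℕ, k = κ := ⟨k.toNat, by omega⟩
      have hκ : κ ≠ 1 := by rintro rfl; norm_num at hk3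
      have hmf := Nat.minFac_prime hκ
      have hpk := hVp _ hmf (by exact_mod_cast Nat.minFac_dvd κ)
      have hpκ : p ∣ κ := by rw [← hpk.1]; exact Nat.minFac_dvd κ
      have hpκ' : (p:ℤ) ∣ (κ:ℤ) := by exact_mod_cast hpκ
      have hpD : ¬ (p:ℤ) ∣ D := by rw [← hpk.1]; exact hpk.2
      have hc : c = 0 := by
        by_contra hc
        exact hpD (by rw [hD]; exact (dvd_pow_self _ hc).mul_right _)
      have hpN : (p:ℤ) ∣ N := by rw [hN]; exact (dvd_pow_self _ hb.ne').mul_right _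
      have hpy : ¬ (p:ℤ) ∣ y := by
        intro h
        have h1 : (p:ℤ) ∣ D * y^2 := (h.trans (dvd_pow_self y (by norm_num))).mul_left _
        have h2 := dvd_sub h1 hpκ'
        have h3 : (p:ℤ) ∣ 2*σ := by
          have e2 : 2*σ = D*y^2 - κ := by linarith
          rw [e2]; exact h2
        have h4 : (p:ℤ) ∣ 2*σ*σ := h3.mul_right _
        rw [show 2*σ*σ = 2 by linear_combination 2*hσ2] at h4
        exact hno2 p hp hpN h4
      have hpR : ¬ (p:ℤ) ∣ R := fun h => hpD (hRD p hp h)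
      have hκp : ∃ e, κ = p^e := by
        refine ⟨_, Nat.eq_prime_pow_of_unique_prime_dvd (by omega) (fun {q} hq h => (hVp q hq (by exact_mod_cast h)).1)⟩
      obtain ⟨e, he⟩ := hκp
      have he' : (κ:ℤ) = (p:ℤ)^e := by exact_mod_cast he
      have hyR : y ∣ R := by
        have h3 : y ∣ (p:ℤ)^b * R := by rw [← hN, hn]; exact dvd_mul_right _ _
        have h4 : IsCoprime y ((p:ℤ)^b) := ((hp'.coprime_iff_not_dvd.2 hpy).symm).pow_right
        exact h4.dvd_of_dvd_mul_left h3
      have hRy : R ∣ y := by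
        have h3 : R ∣ y * (p:ℤ)^e := by rw [← he', ← hn, hN]; exact dvd_mul_left _ _
        have h4 : IsCoprime R ((p:ℤ)^e) := ((hp'.coprime_iff_not_dvd.2 hpR).symm).pow_right
        exact h4.dvd_of_dvd_mul_right h3
      have hyR' : y = R := Int.dvd_antisymm hy.le hR0.le hyR hRy
      refine ⟨hpy, ?_, hyR', hc⟩
      have h1 : (p:ℤ)^b = κ := by
        have : (p:ℤ)^b * R = κ * R := by rw [← hN, hn, hyR']; ring
        exact mul_right_cancel₀ hR0.ne' this
      rw [h1, hk, hD, hc, hyR']; ring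
    · exfalso
      obtain ⟨i, rfl⟩ : ∃ i, m = i + 2 := ⟨m-2, by omega⟩
      have hg := lucU_gt k hk3 i
      have hUmd : lucU k (i+2) ∣ lucU k (i+2+(i+2)) := by rw [hdb]; exact dvd_mul_right _ _
      have hpU : ¬ (p:ℤ) ∣ lucU k (i+2) := by
        intro h
        -- V has a prime factor, which must be p
        have hV1 : (lucV k (i+2)).natAbs ≠ 1 := by
          intro h1
          have h2 := lucV_sq k (i+2)
          rw [← Int.natAbs_sq, h1] at h2
          have h5 : 0 ≤ (k^2-4) * lucU k (i+2)^2 := mul_nonneg (by nlinarith) (sq_nonneg _)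
          norm_num at h2
          linarith
        have hmf := Nat.minFac_prime hV1
        have hdv : ((lucV k (i+2)).natAbs.minFac : ℤ) ∣ lucV k (i+2) :=
          Int.natCast_dvd.2 (Nat.minFac_dvd _)
        have h1 := (hVp _ hmf hdv).1
        rw [h1] at hdv
        have h2 : (p:ℤ) ∣ lucV k (i+2) ^ 2 := dvd_pow hdv (by norm_num)
        have h3 : (p:ℤ) ∣ (k^2-4) * lucU k (i+2) ^ 2 :=
          (dvd_pow h (by norm_num)).mul_left _
        rw [← lucV_sq] at h3
        have h4 := dvd_sub h2 h3
        simp at h4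
        exact hno4 p hp (hdv.trans hVN) h4
      have hUR := hcop _ hUmd hpU
      have hUodd : Odd (lucU k (i+2)) := by rw [hdb] at hUo; exact (Int.odd_mul.1 hUo).1
      have := luc_dvd k hko (i+2) hUodd (lucU k (i+2)) (by linarith) dvd_rfl
        (fun q hq h => hD4 _ (hRD q hq (h.trans hUR)))
      have := Int.le_of_dvd (by positivity) this
      push_cast at this
      linarith
  · -- odd index
    rcases Nat.eq_zero_or_pos m with rfl | hm0
    · left
      rw [hm] at hn
      simp [lucU] at hn
      exact hn.symm
    right; right
    have hm' : n + 1 = m + m + 1 := by omega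
    rw [hm'] at hn hUo hUN hcop
    have hod := lucU_odd k m
    have hgr := lucU_growth k hk3 m
    have hpAB : ¬ (p:ℤ) ∣ lucU k (m+1) - lucU k m ∨ ¬ (p:ℤ) ∣ lucU k (m+1) + lucU k m := by
      by_contra hcon
      push Not at hcon
      obtain ⟨h1, h2⟩ := hcon
      have hpN : (p:ℤ) ∣ N := by rw [hN]; exact (dvd_pow_self _ hb.ne').mul_right _
      have h2' := hno2 p hp hpN
      have h3 : (p:ℤ) ∣ 2 * lucU k m := by
        have e2 : 2 * lucU k m = (lucU k (m+1) + lucU k m) - (lucU k (m+1) - lucU k m) := by ring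
        rw [e2]; exact dvd_sub h2 h1
      have h4 := (hp'.dvd_or_dvd h3).resolve_left h2'
      have h5 : (p:ℤ) ∣ lucU k (m+1) := by
        have := dvd_add h1 h4
        simpa using this
      have h6 : (p:ℤ) ∣ 1 := by
        rw [← lucU_inv k m]
        refine dvd_add (dvd_sub (dvd_pow h5 (by norm_num)) (h4.mul_left _)) (dvd_pow h4 (by norm_num))
      exact hp'.not_dvd_one h6
    have hle : lucU k (m+1) - lucU k m ≤ 2*m+1 := by
      have gen : ∀ F : ℤ, 0 < F → F ∣ lucU k (m+m+1) → ¬ (p:ℤ) ∣ F → F ≤ 2*m+1 := by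
        intro F hF hFd hpF
        have hFR := hcop F hFd hpF
        have := luc_dvd k hko (m+m+1) hUo F hF hFd
          (fun q hq h => hD4 _ (hRD q hq (h.trans hFR)))
        have := Int.le_of_dvd (by positivity) this
        push_cast at this
        linarith
      rcases hpAB with h | h
      · exact gen _ (by linarith) (by rw [hod]; exact dvd_mul_right _ _) h
      · have := gen _ (by linarith) (by rw [hod]; exact dvd_mul_left _ _) h
        linarith
    have hm1 : m ≠ 1 := by
      rintro rfl
      exact lucU_even k hko _ hUo (by norm_num)
    have hm3 : m < 3 := by
      by_contra hc
      obtain ⟨i, rfl⟩ : ∃ i, m = i + 3 := ⟨m-3, by omega⟩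
      have := lucA_growth k hk3 i
      push_cast at hle
      have e : i + 3 + 1 = i + 4 := by ring
      rw [e] at hle
      linarith
    have hm2 : m = 2 := by omega
    subst hm2
    have hk33 : k = 3 := by
      simp [lucU] at hle
      nlinarith
    have hU5 : lucU k (2+2+1) = 55 := by rw [hk33]; simp [lucU]
    have hD3 : 3 ≤ D := by
      have : 1 ≤ (p:ℤ)^c := by exact_mod_cast Nat.one_le_pow _ _ hp.pos
      rw [hD]; nlinarith
    rw [hU5] at hn
    have hy1 : y = 1 := by
      by_contra hne
      have : 2 ≤ y := by omega
      rcases hσ with rfl | rfl <;> nlinarith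
    subst hy1
    refine ⟨rfl, ?_, by linarith, ?_⟩ <;> rcases hσ with rfl | rfl <;> linarith

theorem luc_core (p : ℕ) (hp : p.Prime) (hpodd : Odd p) (b c : ℕ) (hb : 0 < b)
    (R Q : ℤ) (hR0 : 0 < R) (hQ : 3 ≤ Q) (hRo : Odd R) (hQo : Odd Q)
    (hRQ : ∀ q : ℕ, q.Prime → (q:ℤ) ∣ R → (q:ℤ) ∣ Q)
    (σ : ℤ) (hσ : σ = 1 ∨ σ = -1) (x y : ℤ) (hx : 0 < x) (hy : 0 < y) (hyodd : Odd y)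
    (N D : ℤ) (hN : N = (p:ℤ)^b * R) (hD : D = (p:ℤ)^c * Q)
    (heq : x^2 = (N*D)^2*y^2 - 4*σ*(N*D)*N + 4) :
    y = N ∨ (¬ (p:ℤ) ∣ y ∧ (p:ℤ)^b = R*Q*R - 2*σ ∧ y = R ∧ c = 0) ∨
      (y = 1 ∧ D = 5 ∧ N = 55 ∧ σ = 1) := by
  have hpo : Odd (p:ℤ) := by exact_mod_cast hpodd
  have hNo : Odd N := by rw [hN]; exact (hpo.pow).mul hRo
  have hDo : Odd D := by rw [hD]; exact (hpo.pow).mul hQo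
  have hσ2 : σ^2 = 1 := by rcases hσ with rfl | rfl <;> norm_num
  have hD3 : 3 ≤ D := by
    have : 1 ≤ (p:ℤ)^c := by exact_mod_cast Nat.one_le_pow _ _ hp.pos
    rw [hD]; nlinarith
  have hN3 : 3 ≤ N := by
    have h2 : 3 ≤ p := by
      have := hp.two_le
      rcases hpodd with ⟨j, hj⟩; omega
    have h1 : 3 ≤ (p:ℤ)^b := by
      have : p ^ 1 ≤ p ^ b := Nat.pow_le_pow_right hp.pos hb
      rw [pow_one] at this
      have : 3 ≤ p ^ b := h2.trans this
      exact_mod_cast this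
    rw [hN]; nlinarith
  obtain ⟨M, hM⟩ : ∃ M, M = N * D := ⟨_, rfl⟩
  rw [← hM] at heq
  have hMo : Odd M := by rw [hM]; exact hNo.mul hDo
  have hM9 : 9 ≤ M := by rw [hM]; nlinarith
  have hxo : Odd x := by
    have : Odd (x^2) := by
      rw [heq, show M^2*y^2 - 4*σ*M*N + 4 = (M*y)^2 + 2*(-2*σ*M*N+2) by ring]
      exact (hMo.mul hyodd).pow.add_even ⟨-2*σ*M*N+2, by ring⟩
    rcases Int.even_or_odd x with h | h
    · exact absurd (h.pow_of_ne_zero (by norm_num : (2:ℕ) ≠ 0)) (Int.not_even_iff_odd.2 this)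
    · exact h
  obtain ⟨d, hd⟩ := (hMo.mul hyodd).sub_odd hxo
  have hd2 : d^2 - 1 = M * (d*y - σ*N) := by
    have hx' : x = M*y - 2*d := by linarith
    rw [hx'] at heq
    linarith
  obtain ⟨w, hw⟩ : ∃ w, w = d*y - σ*N := ⟨_, rfl⟩
  rw [← hw] at hd2
  have hprod : d*(d+x) = σ*M*N - 1 := by
    have hx' : x = M*y - 2*d := by linarith
    rw [hx']; linear_combination (-1)*hd2 - M*hw
  have hMN : 27 ≤ M*N := by nlinarith
  have hd0 : d ≠ 0 := by
    rintro rfl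
    rcases hσ with rfl | rfl <;> nlinarith
  have hd1 : 1 ≤ d^2 := by
    have := pow_pos (abs_pos.2 hd0) 2
    rw [sq_abs] at this; omega
  have hw0 : 0 ≤ w := by
    by_contra hc
    push Not at hc
    nlinarith
  have hwN : w < N := by
    have h1 : d^2 < (d+x)^2 := by
      have : 0 < x*(M*y) := by positivity
      have h2 : 2*d + x = M*y := by linarith
      nlinarith
    have h2 : (d^2)^2 < (M*N+1)^2 := by
      have h3 : d^2*d^2 < d^2*(d+x)^2 := mul_lt_mul_of_pos_left h1 (by linarith)
      have h4 : d^2*(d+x)^2 = (σ*M*N-1)^2 := by rw [← hprod]; ring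
      have h5 : (σ*M*N-1)^2 ≤ (M*N+1)^2 := by
        rcases hσ with rfl | rfl <;> nlinarith
      nlinarith
    have h3 : d^2 < M*N+1 := lt_of_pow_lt_pow_left₀ 2 (by linarith) h2
    have h4 : M*w < M*N := by linarith
    exact lt_of_mul_lt_mul_left h4 (by linarith)
  obtain ⟨k, hk⟩ : ∃ k, k = D*y^2 - 2*σ := ⟨_, rfl⟩
  have hrel : N^2 + w^2 - k*N*w = y^2 := by
    rw [hk]
    rw [hM] at hd2
    have h1 : (d*y)^2 = (w + σ*N)^2 := by rw [hw]; ring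
    linear_combination (-1)*h1 + y^2*hd2 + (-N^2)*hσ2
  have hy1 : 1 ≤ y^2 := by nlinarith
  have hky : y^2 ≤ k := by
    rw [hk]
    rcases hσ with rfl | rfl <;> nlinarith
  have hko : Odd k := by
    rw [hk]; exact (hDo.mul hyodd.pow).sub_even ⟨σ, by ring⟩
  have hk3 : 3 ≤ k := by
    have hk1 : k ≠ 1 := by
      rintro rfl
      have hy2 : y^2 = 1 := by linarith
      have h9 : 9 ≤ N^2 := by nlinarith only [hN3]
      have h4 := sq_nonneg (N-2*w)
      linarith
    rcases hko with ⟨j, hj⟩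
    omega
  obtain ⟨n, hn, -⟩ := luc_descent k y hy hky w.toNat N w hw0 hwN (by omega) hrel
  exact luc_core2 p hp hpodd b c hb R Q hR0 hQ hRo hQo hRQ σ hσ y hy hyodd N D k hN hD hk hk3 n hn

/-- For an odd prime `p`, odd integers `k₁, …, k_s > 1`, exponents `tᵢ > rᵢ`,
`a ≥ b ≥ 1` and `δ = ±4`, any solution in positive integers `x, y` with `y`
odd of `x² = p^{2a} ∏ kᵢ^{2tᵢ} · y² − δ p^{a+b} ∏ kᵢ^{tᵢ+rᵢ} + 4` is of one of
two explicit shapes, apart from one exceptional solution. -/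
theorem ma_type_four (p : ℕ) (hp : p.Prime) (hpodd : Odd p)
    (s a b : ℕ) (hs : 0 < s) (ha : 0 < a) (hb : 0 < b) (hab : b ≤ a)
    (k : Fin s → ℤ) (hkodd : ∀ i, Odd (k i)) (hk1 : ∀ i, 1 < k i)
    (t : Fin s → ℕ) (r : Fin s → ℕ) (ht : ∀ i, 0 < t i) (htr : ∀ i, r i < t i)
    (δ : ℤ) (hδ : δ = 4 ∨ δ = -4)
    (x y : ℤ) (hx : 0 < x) (hy : 0 < y) (hyodd : Odd y)
    (heq : x ^ 2 = (p : ℤ) ^ (2 * a) * (∏ i, (k i) ^ (2 * t i)) * y ^ 2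
      - δ * (p : ℤ) ^ (a + b) * (∏ i, (k i) ^ (t i + r i)) + 4)
    (hexc : ¬ (x = 123 ∧ y = 1 ∧ p = 11 ∧ s = 1 ∧
      (∀ i, r i = 1) ∧ (∀ i, t i = 2) ∧ (∀ i, k i = 5) ∧
      a = 1 ∧ b = 1 ∧ δ = 4)) :
    ((p : ℤ) ∣ y ∧
      x = (p : ℤ) ^ (a + b) * (∏ i, (k i) ^ (t i + r i)) - δ / 2 ∧
      y = (p : ℤ) ^ b * (∏ i, (k i) ^ (r i))) ∨
    (¬ (p : ℤ) ∣ y ∧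
      (p : ℤ) ^ b = (∏ i, (k i) ^ (t i + r i)) - δ / 2 ∧
      x = (p : ℤ) ^ (2 * b) - 2 ∧
      y = (∏ i, (k i) ^ (r i)) ∧ a = b) := by
  have hKR : ∏ i, (k i) ^ (t i) = (∏ i, (k i) ^ (r i)) * ∏ i, (k i) ^ (t i - r i) := by
    rw [← Finset.prod_mul_distrib]
    refine Finset.prod_congr rfl fun i _ => ?_
    rw [← pow_add]; congr 1; have := htr i; omega
  have h2t : ∏ i, (k i) ^ (2 * t i) = (∏ i, (k i) ^ (t i)) ^ 2 := by
    rw [← Finset.prod_pow]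
    refine Finset.prod_congr rfl fun i _ => ?_
    rw [mul_comm, pow_mul]
  have htr2 : ∏ i, (k i) ^ (t i + r i) = (∏ i, (k i) ^ (t i)) * ∏ i, (k i) ^ (r i) := by
    rw [← Finset.prod_mul_distrib]
    refine Finset.prod_congr rfl fun i _ => ?_
    rw [pow_add]
  obtain ⟨R, hR⟩ : ∃ R, R = ∏ i, (k i) ^ (r i) := ⟨_, rfl⟩
  obtain ⟨Q, hQ⟩ : ∃ Q, Q = ∏ i, (k i) ^ (t i - r i) := ⟨_, rfl⟩
  have hk3 : ∀ i, 3 ≤ k i := by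
    intro i
    have h1 := hk1 i
    rcases hkodd i with ⟨j, hj⟩
    omega
  have hpow3 : ∀ i, 3 ≤ (k i) ^ (t i - r i) := by
    intro i
    have h1 : (k i)^1 ≤ (k i) ^ (t i - r i) :=
      pow_le_pow_right₀ (by linarith [hk3 i]) (by have := htr i; omega)
    rw [pow_one] at h1
    exact (hk3 i).trans h1
  have hone : ∀ S : Finset (Fin s), 1 ≤ ∏ i ∈ S, (k i) ^ (t i - r i) := by
    intro S
    have : 0 < ∏ i ∈ S, (k i) ^ (t i - r i) :=
      Finset.prod_pos fun i _ => by linarith [hpow3 i]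
    omega
  have hsplit : ∀ i, Q = (k i) ^ (t i - r i) * ∏ j ∈ Finset.univ.erase i, (k j) ^ (t j - r j) := by
    intro i
    rw [hQ, Finset.mul_prod_erase _ (fun j => (k j) ^ (t j - r j)) (Finset.mem_univ i)]
  have hQ3 : 3 ≤ Q := by
    have i : Fin s := ⟨0, hs⟩
    rw [hsplit i]
    nlinarith [hpow3 i, hone (Finset.univ.erase i)]
  have hR0 : 0 < R := by
    rw [hR]; exact Finset.prod_pos fun i _ => pow_pos (by linarith [hk3 i]) _
  have hoddprod : ∀ e : Fin s → ℕ, Odd (∏ i, (k i) ^ (e i)) := by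
    intro e
    refine Finset.prod_induction _ Odd (fun _ _ h1 h2 => h1.mul h2) odd_one
      (fun i _ => (hkodd i).pow)
  have hRo : Odd R := by rw [hR]; exact hoddprod _
  have hQo : Odd Q := by rw [hQ]; exact hoddprod (fun i => t i - r i)
  have hRQ : ∀ q : ℕ, q.Prime → (q:ℤ) ∣ R → (q:ℤ) ∣ Q := by
    intro q hq h
    have hq' : Prime (q:ℤ) := Nat.prime_iff_prime_int.mp hq
    rw [hR] at h
    obtain ⟨i, -, hi⟩ := (hq'.dvd_finsetProd_iff _).1 h
    have h1 := hq'.dvd_of_dvd_pow hi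
    rw [hsplit i]
    exact (dvd_pow h1 (by have := htr i; omega)).mul_right _
  rw [← hR, ← hQ] at hKR
  rw [← hR, hKR] at htr2
  rw [hKR] at h2t
  rw [h2t, htr2] at heq
  rw [htr2, ← hR]
  obtain ⟨σ, hσd, hσ, hσ2⟩ : ∃ σ : ℤ, δ = 4 * σ ∧ (σ = 1 ∨ σ = -1) ∧ δ / 2 = 2 * σ := by
    rcases hδ with rfl | rfl
    · exact ⟨1, by norm_num⟩
    · exact ⟨-1, by norm_num⟩
  rw [hσ2]
  obtain ⟨c, hc⟩ : ∃ c, a = b + c := ⟨a - b, by omega⟩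
  subst hc
  have hsq : σ^2 = 1 := by rcases hσ with rfl | rfl <;> norm_num
  have hp3 : 3 ≤ (p:ℤ) := by
    have := hp.two_le
    rcases hpodd with ⟨j, hj⟩; omega
  have hpb : ∀ e : ℕ, 0 < e → 3 ≤ (p:ℤ)^e := by
    intro e he
    have h1 : (p:ℤ)^1 ≤ (p:ℤ)^e := pow_le_pow_right₀ (by linarith) he
    rw [pow_one] at h1
    exact hp3.trans h1
  have heq' : x^2 = (((p:ℤ)^b*R)*((p:ℤ)^c*Q))^2*y^2
      - 4*σ*(((p:ℤ)^b*R)*((p:ℤ)^c*Q))*((p:ℤ)^b*R) + 4 := by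
    rw [heq, hσd]; ring
  rcases luc_core p hp hpodd b c hb R Q hR0 hQ3 hRo hQo hRQ σ hσ x y hx hy hyodd _ _ rfl rfl heq'
    with h | ⟨h1, h2, h3, h4⟩ | ⟨h1, h2, h3, h4⟩
  · left
    refine ⟨?_, ?_, h⟩
    · rw [h]; exact (dvd_pow_self _ hb.ne').mul_right _
    · have hbig : 3 ≤ (p:ℤ)^(b+c+b) * (R*Q*R) := by
        have h5 := hpb (b+c+b) (by omega)
        have h6 : 1 ≤ R*Q*R := by
          have : 0 < R*Q*R := by positivity
          omega
        nlinarith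
      refine (pow_left_inj₀ hx.le ?_ (by norm_num : (2:ℕ) ≠ 0)).1 ?_
      · rcases hσ with rfl | rfl <;> linarith
      · rw [heq', h]; linear_combination (-4)*hsq
  · right
    subst h4
    subst h3
    refine ⟨h1, h2, ?_, rfl, rfl⟩
    have h5 := hpb (2*b) (by omega)
    refine (pow_left_inj₀ hx.le (by linarith) (by norm_num : (2:ℕ) ≠ 0)).1 ?_
    rw [heq', pow_zero]
    have h6 : y*Q*y = (p:ℤ)^b + 2*σ := by linarith
    have e : (((p:ℤ)^b*y)*(1*Q))^2*y^2 - 4*σ*(((p:ℤ)^b*y)*(1*Q))*((p:ℤ)^b*y) + 4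
      = ((p:ℤ)^b)^2*(y*Q*y)^2 - 4*σ*((p:ℤ)^b)^2*(y*Q*y) + 4 := by ring
    rw [e, h6, mul_comm 2 b, pow_mul]
    linear_combination (-4) * ((p:ℤ)^b)^2 * hsq
  · exfalso
    have hc0 : c = 0 := by
      by_contra hc
      have h5 := hpb c (by omega)
      nlinarith
    subst hc0
    rw [pow_zero, one_mul] at h2
    have hs1 : s = 1 := by
      by_contra hne
      have h01 : (⟨1, by omega⟩ : Fin s) ∈ Finset.univ.erase (⟨0, hs⟩ : Fin s) := by
        simp
      have h5 := hsplit ⟨0, hs⟩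
      rw [← Finset.mul_prod_erase _ (fun j => (k j) ^ (t j - r j)) h01] at h5
      have h6 := hpow3 ⟨0, hs⟩
      have h7 := hpow3 ⟨1, by omega⟩
      have h8 := hone ((Finset.univ.erase (⟨0, hs⟩ : Fin s)).erase ⟨1, by omega⟩)
      rw [h2] at h5
      nlinarith [mul_le_mul h7 h8 (by norm_num) (by linarith)]
    subst hs1
    simp only [Fin.prod_univ_one, Finset.univ_unique, Finset.prod_singleton, Fin.default_eq_zero] at hR hQ
    rw [h2] at hQ
    have h50 : Prime (5:ℤ) := by norm_num
    have htr0 : t 0 - r 0 = 1 := by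
      by_contra hne
      have h5 : 2 ≤ t 0 - r 0 := by have := htr 0; omega
      have h6 : (k 0)^2 ≤ (k 0)^(t 0 - r 0) := pow_le_pow_right₀ (by linarith [hk3 0]) h5
      nlinarith [hk3 0]
    rw [htr0, pow_one] at hQ
    have hr1 : r 0 = 1 := by
      rw [← hQ] at hR
      rcases Nat.lt_or_ge (r 0) 2 with h5 | h5
      · have : r 0 ≠ 0 := by
          intro h0
          rw [h0, pow_zero] at hR
          rw [hR, mul_one] at h3
          have h3' : p^b = 55 := by exact_mod_cast h3
          have h6 : 5 ∣ p := Nat.Prime.dvd_of_dvd_pow (n := b) (by norm_num) (by rw [h3']; norm_num)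
          have h7 : 11 ∣ p := Nat.Prime.dvd_of_dvd_pow (n := b) (by norm_num) (by rw [h3']; norm_num)
          have h8 := (Nat.prime_dvd_prime_iff_eq (by norm_num) hp).1 h6
          have h9 := (Nat.prime_dvd_prime_iff_eq (by norm_num) hp).1 h7
          omega
        omega
      · have h6 : (5:ℤ)^2 ∣ R := by rw [hR]; exact pow_dvd_pow _ h5
        have h7 : (5:ℤ)^2 ∣ 55 := by rw [← h3]; exact h6.mul_left _
        norm_num at h7
    rw [hr1, ← hQ, pow_one] at hR
    rw [hR] at h3
    have h3' : p^b = 11 := by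
      have : (p:ℤ)^b = 11 := by linarith
      exact_mod_cast this
    have hp11 : p = 11 := by
      have h7 : 11 ∣ p := Nat.Prime.dvd_of_dvd_pow (n := b) (by norm_num) (by rw [h3'])
      exact ((Nat.prime_dvd_prime_iff_eq (by norm_num) hp).1 h7).symm
    subst hp11
    have hb1 : b = 1 := by
      have : 11^b = 11^1 := by rw [h3']; norm_num
      exact Nat.pow_right_injective (by norm_num) this
    subst hb1
    have hx123 : x = 123 := by
      rw [h1, h4, hR, h2] at heq'
      norm_num at heq'
      nlinarith
    refine hexc ⟨hx123, h1, rfl, rfl, ?_, ?_, ?_, rfl, rfl, by rw [hσd, h4]; norm_num⟩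
    · intro i; rw [Subsingleton.elim i 0]; exact hr1
    · intro i; rw [Subsingleton.elim i 0]; omega
    · intro i; rw [Subsingleton.elim i 0]; exact hQ.symm
end
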